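/- arXiv:2102.00712 — 4 statements merged into one kernel-verified Lean document; each statement's English description precedes it below -/
import Mathlib

section
/- Let p be a prime, n ≥ 2 an integer, F an algebraically closed field of characteristic p, G = SL_n(𝔽_p), and V_n the standard n-dimensional FG-module. There exists a simple FG-module W such that the shortest directed path in the McKay graph Γ = M_F(G, V_n) from the class of the trivial FG-module F to the class of W has length exactly (1/2)(p−1)(n²−n). -/
open scoped TensorProduct

universe u

/-- A bundled representation of a group `G` over a field `F`
(an `FG`-module together with its `G`-action). -/
structure GRep (F : Type u) (G : Type*) [Field F] [Monoid G] where
  V : Type u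
  [instAddCommGroup : AddCommGroup V]
  [instModule : Module F V]
  ρ : Representation F G V

attribute [instance] GRep.instAddCommGroup GRep.instModule

variable {F : Type u} [Field F] {G : Type*} [Group G]

/-- A subspace of the underlying space of an `FG`-module is `G`-invariant
(i.e. is an `FG`-submodule). -/
def GRep.Invariant (A : GRep F G) (q : Submodule F A.V) : Prop :=
  ∀ g : G, ∀ x ∈ q, A.ρ g x ∈ q

/-- An `FG`-module is simple (irreducible): it is nonzero and its only
`FG`-submodules are `⊥` and `⊤`. -/
def GRep.IsSimple (A : GRep F G) : Prop :=
  Nontrivial A.V ∧ ∀ q : Submodule F A.V, A.Invariant q → q = ⊥ ∨ q = ⊤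

/-- `B` is (isomorphic to) a composition factor of `A`: there are `FG`-submodules
`p' ≤ q` of `A` and a surjective `F`-linear, `G`-equivariant map `q → B` with
kernel `p'`, i.e. `B ≅ q / p'` as `FG`-modules. -/
def GRep.IsCompFactor (A B : GRep F G) : Prop :=
  ∃ (q : Submodule F A.V) (hq : A.Invariant q) (p' : Submodule F A.V),
    A.Invariant p' ∧ p' ≤ q ∧
    ∃ φ : q →ₗ[F] B.V, Function.Surjective φ ∧
      LinearMap.ker φ = p'.comap q.subtype ∧
      ∀ (g : G) (x : q), φ ⟨A.ρ g x, hq g x x.2⟩ = B.ρ g (φ x)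

/-- The tensor product `A ⊗_F B` with the diagonal `G`-action. -/
noncomputable def GRep.tensor (A B : GRep F G) : GRep F G :=
  ⟨A.V ⊗[F] B.V, A.ρ.tprod B.ρ⟩

/-- The edge relation of the McKay graph `M_F(G, S)`: there is an edge from `A` to `B`
iff `B` is a composition factor of `A ⊗_F S`. -/
def McKayEdge (S A B : GRep F G) : Prop := (A.tensor S).IsCompFactor B

/-- `c` is a directed path of length `k` from `A` to `B` in the McKay graph
`M_F(G, S)`: all its vertices are simple `FG`-modules and consecutive vertices
are joined by an edge. -/
def McKayPath (S A B : GRep F G) (k : ℕ) (c : ℕ → GRep F G) : Prop :=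
  c 0 = A ∧ c k = B ∧ (∀ j ≤ k, (c j).IsSimple) ∧ ∀ j < k, McKayEdge S (c j) (c (j + 1))

/-- `SL_n(𝔽_p)`. -/
abbrev SLP (n p : ℕ) := Matrix.SpecialLinearGroup (Fin n) (ZMod p)

/-- The standard `n`-dimensional module `V_n = F^n` for `SL_n(𝔽_p)`, where `F` has
characteristic `p`, with the action given by matrix multiplication via `𝔽_p ↪ F`. -/
noncomputable def stdRep (p n : ℕ) (F : Type u) [Field F] [CharP F p] : GRep F (SLP n p) :=
  ⟨Fin n → F,
    (Units.coeHom ((Fin n → F) →ₗ[F] (Fin n → F))).comp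
      ((Matrix.GeneralLinearGroup.toLin.toMonoidHom).comp
        ((Matrix.SpecialLinearGroup.toGL).comp
          (Matrix.SpecialLinearGroup.map (ZMod.castHom dvd_rfl F))))⟩

/-- The trivial one-dimensional `FG`-module `F`. -/
noncomputable def trivialGRep (F : Type u) [Field F] (G : Type*) [Group G] : GRep F G :=
  ⟨F, Representation.trivial F (G := G) (V := F)⟩

namespace MK

/-- equivariant -/
def Equi (A B : GRep F G) (φ : A.V →ₗ[F] B.V) : Prop := ∀ g x, φ (A.ρ g x) = B.ρ g (φ x)

noncomputable def act (A : GRep F G) (a : MonoidAlgebra F G) : Module.End F A.V :=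
  A.ρ.asAlgebraHom a

lemma act_mul (A : GRep F G) (a b : MonoidAlgebra F G) (x : A.V) :
    act A (a * b) x = act A a (act A b x) := by
  simp [act]

lemma Equi.act {A B : GRep F G} {φ : A.V →ₗ[F] B.V} (h : Equi A B φ) (a : MonoidAlgebra F G)
    (x : A.V) : φ (act A a x) = MK.act B a (φ x) := by
  unfold MK.act
  induction a using MonoidAlgebra.induction_on with
  | of g => simp [h g x]
  | add a b ha hb => simp [ha, hb]
  | smul r a ha => simp [ha]

def NN (e : MonoidAlgebra F G) (A : GRep F G) : Prop := ∀ m : ℕ, act A (e ^ m) ≠ 0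

lemma ext_nil {A B C : GRep F G} {f : A.V →ₗ[F] B.V} {g : B.V →ₗ[F] C.V} (hf : Equi A B f)
    (hg : Equi B C g) (hex : Function.Exact f g) (e : MonoidAlgebra F G)
    (hB : NN e B) : NN e A ∨ NN e C := by
  by_contra hcon
  rw [not_or] at hcon
  obtain ⟨hA, hC⟩ := hcon
  unfold NN at hA hC
  push Not at hA hC
  obtain ⟨m, hm⟩ := hA
  obtain ⟨k, hk⟩ := hC
  apply hB (m + k)
  ext x
  rw [pow_add, act_mul]
  have h1 : g (act B (e ^ k) x) = 0 := by rw [hg.act, hk]; rfl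
  obtain ⟨y, hy⟩ := (hex _).1 h1
  rw [← hy, ← hf.act, hm]
  simp

lemma NN_of_inj {A B : GRep F G} {f : A.V →ₗ[F] B.V} (hf : Equi A B f)
    (hi : Function.Injective f) {e : MonoidAlgebra F G} (hA : NN e A) : NN e B := by
  intro m hm
  apply hA m
  ext x
  apply hi
  rw [hf.act, hm]
  simp

noncomputable def sub (A : GRep F G) (q : Submodule F A.V) (hq : A.Invariant q) : GRep F G :=
  ⟨q, { toFun := fun g => (A.ρ g).restrict (hq g)
        map_one' := by ext; simp
        map_mul' := by intros; ext; simp }⟩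

noncomputable def quo (A : GRep F G) (q : Submodule F A.V) (hq : A.Invariant q) : GRep F G :=
  ⟨A.V ⧸ q, { toFun := fun g => q.mapQ q (A.ρ g) (hq g)
              map_one' := by ext; simp
              map_mul' := by intros; ext; simp }⟩

lemma Equi.rTensor {A B : GRep F G} {f : A.V →ₗ[F] B.V} (hf : Equi A B f) (C : GRep F G) :
    Equi (A.tensor C) (B.tensor C) (LinearMap.rTensor C.V f) := by
  intro g x
  change (LinearMap.rTensor C.V f) ((A.ρ.tprod C.ρ) g x) = (B.ρ.tprod C.ρ) g (LinearMap.rTensor C.V f x)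
  induction x using TensorProduct.induction_on with
  | zero => simp
  | tmul a c => simp [hf g a]
  | add x y hx hy => simp only [map_add, hx, hy]

lemma core (A B : GRep F G) [FiniteDimensional F A.V] (e : MonoidAlgebra F G)
    (h : NN e (A.tensor B)) : ∃ S : GRep F G, S.IsSimple ∧ A.IsCompFactor S ∧
      FiniteDimensional F S.V ∧ NN e (S.tensor B) := by
  let P : Set (Submodule F A.V) := {q | ∃ hq : A.Invariant q, NN e ((sub A q hq).tensor B)}
  have hP : P.Nonempty := by
    refine ⟨⊤, fun _ _ _ => trivial, ?_⟩
    let f : A.V →ₗ[F] (sub A ⊤ (fun _ _ _ => trivial)).V :=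
      (Submodule.topEquiv (R := F) (M := A.V)).symm.toLinearMap
    have hf : Equi A (sub A ⊤ (fun _ _ _ => trivial)) f := fun g x => rfl
    refine NN_of_inj (hf.rTensor B) ?_ h
    exact Module.Flat.rTensor_preserves_injective_linearMap f
      (Submodule.topEquiv (R := F) (M := A.V)).symm.injective
  obtain ⟨q, ⟨hq, hqn⟩, hmin⟩ := WellFounded.has_min (wellFounded_lt (α := Submodule F A.V)) P hP
  let Q : Set (Submodule F A.V) := {r | A.Invariant r ∧ r < q}
  have hQ : Q.Nonempty := by
    refine ⟨⊥, fun g x hx => ?_, ?_⟩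
    · simp at hx; simp [hx]
    · rw [bot_lt_iff_ne_bot]
      rintro rfl
      apply hqn 0
      have : Subsingleton ((sub A ⊥ hq).tensor B).V := by
        have : Subsingleton (sub A ⊥ hq).V := inferInstanceAs (Subsingleton (⊥ : Submodule F A.V))
        exact inferInstanceAs (Subsingleton ((sub A ⊥ hq).V ⊗[F] B.V))
      ext x
      exact Subsingleton.elim _ _
  obtain ⟨r, ⟨hr, hrq⟩, hmax⟩ := WellFounded.has_min (wellFounded_gt (α := Submodule F A.V)) Q hQ
  let r' : Submodule F (sub A q hq).V := r.comap q.subtype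
  have hr' : (sub A q hq).Invariant r' := fun g x hx => hr g _ hx
  have hAr : ¬ NN e ((sub A r hr).tensor B) := fun hh => hmin r ⟨hr, hh⟩ hrq
  let f : (sub A r hr).V →ₗ[F] (sub A q hq).V := Submodule.inclusion hrq.le
  have hf : Equi _ _ f := fun g x => rfl
  let π : (sub A q hq).V →ₗ[F] (quo (sub A q hq) r' hr').V := r'.mkQ
  have hπ : Equi _ _ π := fun g x => rfl
  have hex : Function.Exact f π := by
    rw [LinearMap.exact_iff]
    change LinearMap.ker r'.mkQ = LinearMap.range (Submodule.inclusion hrq.le)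
    rw [Submodule.ker_mkQ, Submodule.range_inclusion]
    rfl
  have hsurj : Function.Surjective π := r'.mkQ_surjective
  refine ⟨quo (sub A q hq) r' hr', ⟨?_, ?_⟩, ?_, ?_, ?_⟩
  · change Nontrivial ((sub A q hq).V ⧸ r')
    rw [Submodule.Quotient.nontrivial_iff]
    intro htop
    apply hrq.not_ge
    intro x hx
    have : (⟨x, hx⟩ : q) ∈ r' := by rw [htop]; trivial
    exact this
  · intro s hs
    let s' : Submodule F A.V := (s.comap π).map q.subtype
    have hs' : A.Invariant s' := by
      rintro g _ ⟨x, hx, rfl⟩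
      refine ⟨(sub A q hq).ρ g x, ?_, rfl⟩
      exact hs g (π x) hx
    have hsq : s' ≤ q := by
      rintro _ ⟨x, hx, rfl⟩
      exact x.2
    have hrs : r ≤ s' := by
      intro x hx
      refine ⟨⟨x, hrq.le hx⟩, ?_, rfl⟩
      change π _ ∈ s
      have : π ⟨x, hrq.le hx⟩ = 0 := (Submodule.Quotient.mk_eq_zero r').2 hx
      rw [this]; exact s.zero_mem
    by_cases hlt : s' < q
    · left
      have hle : s' ≤ r := by
        by_contra hne
        exact hmax s' ⟨hs', hlt⟩ (lt_of_le_not_ge hrs hne)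
      rw [eq_bot_iff]
      intro y hy
      obtain ⟨x, rfl⟩ := hsurj y
      have : (q.subtype x) ∈ s' := ⟨x, hy, rfl⟩
      exact (Submodule.Quotient.mk_eq_zero r').2 (hle this)
    · right
      have : q ≤ s' := by
        by_contra hne
        exact hlt (lt_of_le_not_ge hsq hne)
      rw [eq_top_iff]
      intro y _
      obtain ⟨x, rfl⟩ := hsurj y
      obtain ⟨x', hx', he⟩ := this x.2
      have : x' = x := Subtype.ext he
      subst this
      exact hx'
  · refine ⟨q, hq, r, hr, hrq.le, π, hsurj, ?_, ?_⟩
    · exact Submodule.ker_mkQ _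
    · exact fun g x => hπ g x
  · have : FiniteDimensional F (sub A q hq).V := inferInstanceAs (FiniteDimensional F q)
    exact inferInstanceAs (FiniteDimensional F ((sub A q hq).V ⧸ r'))
  · have := ext_nil (hf.rTensor B) (hπ.rTensor B) (rTensor_exact B.V hex hsurj) e hqn
    exact this.resolve_left hAr

lemma assoc_aux {A B C : Type*} [AddCommGroup A] [AddCommGroup B] [AddCommGroup C]
    [Module F A] [Module F B] [Module F C] (a : Representation F G A) (b : Representation F G B)
    (c : Representation F G C) (g : G) (x : A ⊗[F] (B ⊗[F] C)) :
    (TensorProduct.assoc F A B C).symm ((a.tprod (b.tprod c)) g x) =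
      ((a.tprod b).tprod c) g ((TensorProduct.assoc F A B C).symm x) := by
  induction x using TensorProduct.induction_on with
  | zero => simp
  | add x y hx hy => simp only [map_add, hx, hy]
  | tmul a y =>
    induction y using TensorProduct.induction_on with
    | zero => simp
    | add x y hx hy => simp only [TensorProduct.tmul_add, map_add, hx, hy]
    | tmul b c => simp

lemma rid_aux {A : Type*} [AddCommGroup A] [Module F A] (a : Representation F G A) (g : G)
    (x : A ⊗[F] F) : (TensorProduct.rid F A)
        ((a.tprod (Representation.trivial F (G := G) (V := F))) g x) =
          a g ((TensorProduct.rid F A) x) := by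
  induction x using TensorProduct.induction_on with
  | zero => simp
  | add x y hx hy => simp only [map_add, hx, hy]
  | tmul a c => simp

lemma lid_aux {A : Type*} [AddCommGroup A] [Module F A] (a : Representation F G A) (g : G)
    (x : A) : (TensorProduct.lid F A).symm (a g x) =
        ((Representation.trivial F (G := G) (V := F)).tprod a) g
          ((TensorProduct.lid F A).symm x) := by
  simp

lemma assoc_NN (A B C : GRep F G) (e : MonoidAlgebra F G) (h : NN e (A.tensor (B.tensor C))) :
    NN e ((A.tensor B).tensor C) := by
  let f : (A.tensor (B.tensor C)).V →ₗ[F] ((A.tensor B).tensor C).V :=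
    (TensorProduct.assoc F A.V B.V C.V).symm.toLinearMap
  have hf : Equi _ _ f := fun g x => assoc_aux A.ρ B.ρ C.ρ g x
  exact NN_of_inj hf (TensorProduct.assoc F A.V B.V C.V).symm.injective h

/-- tensor powers -/
noncomputable def T (V : GRep F G) : ℕ → GRep F G
  | 0 => trivialGRep F G
  | k + 1 => V.tensor (T V k)

def Reach (S A B : GRep F G) (k : ℕ) : Prop := ∃ c, McKayPath S A B k c

lemma Reach.snoc {S A B C : GRep F G} {k : ℕ} (h : Reach S A B k) (hC : C.IsSimple)
    (he : McKayEdge S B C) : Reach S A C (k + 1) := by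
  obtain ⟨c, h0, hk, hs, hE⟩ := h
  refine ⟨fun j => if j ≤ k then c j else C, by simp [h0], by simp, ?_, ?_⟩
  · intro j hj
    by_cases h : j ≤ k
    · simp [h, hs j h]
    · simp [h, hC]
  · intro j hj
    by_cases h : j < k
    · have h1 : j ≤ k := h.le
      have h2 : j + 1 ≤ k := h
      simp [h1, h2, hE j h]
    · have : j = k := by omega
      subst this
      simp [hk, he]

lemma exists_reach_aux (V A : GRep F G) [FiniteDimensional F V.V] (e : MonoidAlgebra F G) (k : ℕ) :
    ∀ (B : GRep F G) (_ : FiniteDimensional F B.V) (l : ℕ), Reach V A B l → NN e (B.tensor (T V k)) →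
      ∃ W l, Reach V A W l ∧ NN e (W.tensor (trivialGRep F G)) := by
  induction k with
  | zero => exact fun B _ l h1 h2 => ⟨B, l, h1, h2⟩
  | succ k ih =>
    intro B _ l h1 h2
    have h3 : NN e ((B.tensor V).tensor (T V k)) := assoc_NN _ _ _ e h2
    have : FiniteDimensional F (B.tensor V).V :=
      inferInstanceAs (FiniteDimensional F (B.V ⊗[F] V.V))
    obtain ⟨S, hS, hc, hfd, hn⟩ := core (B.tensor V) (T V k) e h3
    exact ih S hfd (l + 1) (h1.snoc hS hc) hn

lemma trivial_simple : (trivialGRep F G).IsSimple := by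
  refine ⟨inferInstanceAs (Nontrivial F), fun q _ => ?_⟩
  exact eq_bot_or_eq_top (α := Ideal F) q

lemma exists_reach (V : GRep F G) [FiniteDimensional F V.V] (e : MonoidAlgebra F G) (k : ℕ)
    (h : NN e (T V k)) :
    ∃ W l, Reach V (trivialGRep F G) W l ∧ act W e ≠ 0 := by
  have h0 : Reach V (trivialGRep F G) (trivialGRep F G) 0 :=
    ⟨fun _ => trivialGRep F G, rfl, rfl, fun _ _ => trivial_simple, fun j hj => by omega⟩
  have h1 : NN e ((trivialGRep F G).tensor (T V k)) := by
    let f : (T V k).V →ₗ[F] ((trivialGRep F G).tensor (T V k)).V :=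
      (TensorProduct.lid F (T V k).V).symm.toLinearMap
    have hf : Equi _ _ f := fun g x => lid_aux (T V k).ρ g x
    exact NN_of_inj hf (TensorProduct.lid F (T V k).V).symm.injective h
  obtain ⟨W, l, hr, hn⟩ := exists_reach_aux V _ e k _
    (inferInstanceAs (FiniteDimensional F F)) 0 h0 h1
  refine ⟨W, l, hr, ?_⟩
  have h2 : NN e W := by
    let f : (W.tensor (trivialGRep F G)).V →ₗ[F] W.V :=
      (TensorProduct.rid F W.V).toLinearMap
    have hf : Equi _ _ f := fun g x => rid_aux W.ρ g x
    exact NN_of_inj hf (TensorProduct.rid F W.V).injective hn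
  have := h2 1
  rwa [pow_one] at this

/-- interpolation -/
lemma interp (V A W : GRep F G) (l d : ℕ) (h : Reach V A W l)
    (hd : ∀ k, Reach V A W k → d ≤ k) :
    ∃ W' : GRep F G, W'.IsSimple ∧ Reach V A W' d ∧ ∀ k, Reach V A W' k → d ≤ k := by
  classical
  have hex : ∃ k, Reach V A W k := ⟨l, h⟩
  let k := Nat.find hex
  obtain ⟨c, h0, hk, hs, hE⟩ : Reach V A W k := Nat.find_spec hex
  have hdk : d ≤ k := hd k (Nat.find_spec hex)
  refine ⟨c d, hs d hdk, ⟨c, h0, rfl, fun j hj => hs j (hj.trans hdk),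
    fun j hj => hE j (by omega)⟩, ?_⟩
  intro m hm
  by_contra hlt
  push Not at hlt
  have key : ∀ i, d + i ≤ k → Reach V A (c (d + i)) (m + i) := by
    intro i
    induction i with
    | zero => intro _; exact hm
    | succ i ih =>
      intro hi
      exact (ih (by omega)).snoc (hs _ hi) (hE _ (by omega))
  have h1 := key (k - d) (by omega)
  rw [show d + (k - d) = k by omega, hk] at h1
  have := Nat.find_min' hex h1
  change k ≤ _ at this
  omega

end MK
namespace MK

noncomputable def R (F : Type u) [Field F] (G : Type*) [Group G] : Representation F G (G → F) where
  toFun g := LinearMap.funLeft F F (fun x => x * g)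
  map_one' := by ext; simp
  map_mul' := by intros; ext; simp [LinearMap.funLeft, mul_assoc]

lemma R_apply (g : G) (f : G → F) (x : G) : R F G g f x = f (x * g) := rfl

noncomputable def lam (a : MonoidAlgebra F G) : (G → F) →ₗ[F] F :=
  (LinearMap.proj (1 : G)).comp ((R F G).asAlgebraHom a)

lemma lam_act (A : GRep F G) (a : MonoidAlgebra F G) (x : A.V) (l : A.V →ₗ[F] F) :
    l (act A a x) = lam a (fun g => l (A.ρ g x)) := by
  unfold act lam
  induction a using MonoidAlgebra.induction_on with
  | of g => simp [R_apply]
  | add a b ha hb => simp_all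
  | smul r a ha => simp_all

def CoefIn (A : GRep F G) (S : Submodule F (G → F)) : Prop :=
  ∀ (x : A.V) (l : A.V →ₗ[F] F), (fun g => l (A.ρ g x)) ∈ S

lemma CoefIn.cf {A B : GRep F G} {S : Submodule F (G → F)} (h : CoefIn A S)
    (hB : A.IsCompFactor B) : CoefIn B S := by
  obtain ⟨q, hq, p', -, -, φ, hφ, -, heq⟩ := hB
  intro x l
  obtain ⟨y, rfl⟩ := hφ x
  obtain ⟨l', hl'⟩ := LinearMap.exists_extend (l.comp φ)
  convert h y l' using 2 with g
  rw [← heq]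
  have := LinearMap.congr_fun hl' ⟨A.ρ g y, hq g y y.2⟩
  simpa using this.symm

lemma act_eq_zero {A : GRep F G} {S : Submodule F (G → F)} (h : CoefIn A S)
    (a : MonoidAlgebra F G) (ha : ∀ f ∈ S, lam a f = 0) : act A a = 0 := by
  ext x
  by_contra hne

  have key : ∀ l : A.V →ₗ[F] F, l (act A a x) = 0 := fun l => by
    rw [lam_act]; exact ha _ (h x l)
  exact hne ((Module.forall_dual_apply_eq_zero_iff F _).1 key)

variable {p n : ℕ} [CharP F p]

variable (F) in
def ent (a b : Fin n) : SLP n p → F := fun g => ZMod.castHom (dvd_refl p) F (g.1 a b)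

variable (F p n) in
noncomputable def sρ : Representation F (SLP n p) (Fin n → F) := (stdRep p n F).ρ

lemma std_apply (g : SLP n p) (v : Fin n → F) (a : Fin n) :
    sρ F p n g v a = ∑ b, ent F a b g * v b := rfl

variable (F p n) in
def PolD (j : ℕ) : Submodule F (SLP n p → F) :=
  Submodule.span F {f | ∃ P : MvPolynomial (Fin n × Fin n) (ZMod p), P.totalDegree ≤ j ∧
    f = fun g => ZMod.castHom (dvd_refl p) F (MvPolynomial.eval (fun ab => g.1 ab.1 ab.2) P)}

lemma ent_mul_mem [Fact p.Prime] (a b : Fin n) (j : ℕ) (f : SLP n p → F) (hf : f ∈ PolD F p n j) :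
    ent F a b * f ∈ PolD F p n (j + 1) := by
  induction hf using Submodule.span_induction with
  | mem f hf =>
    obtain ⟨P, hP, rfl⟩ := hf
    apply Submodule.subset_span
    refine ⟨MvPolynomial.X (a, b) * P, ?_, ?_⟩
    · refine (MvPolynomial.totalDegree_mul _ _).trans ?_
      rw [MvPolynomial.totalDegree_X]; omega
    · ext g; simp [ent]
  | zero => simp
  | add x y _ _ hx hy => rw [mul_add]; exact add_mem hx hy
  | smul r x _ hx => rw [mul_smul_comm]; exact Submodule.smul_mem _ _ hx

lemma coef_aux [Fact p.Prime] {A : Type*} [AddCommGroup A] [Module F A]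
    (ρ : Representation F (SLP n p) A) {j : ℕ}
    (h : ∀ x (l : A →ₗ[F] F), (fun g => l (ρ g x)) ∈ PolD F p n j)
    (x : A ⊗[F] (Fin n → F)) (l : A ⊗[F] (Fin n → F) →ₗ[F] F) :
    (fun g => l ((ρ.tprod (sρ F p n)) g x)) ∈ PolD F p n (j + 1) := by
  induction x using TensorProduct.induction_on with
  | zero => simp only [map_zero]; exact zero_mem _
  | add x y hx hy => simp only [map_add]; exact add_mem hx hy
  | tmul y v =>
    have : (fun g => l ((ρ.tprod (sρ F p n)) g (y ⊗ₜ v))) =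
        ∑ a, ∑ b, v b • (ent F a b *
          (fun g => (l.comp ((TensorProduct.mk F A (Fin n → F)).flip (Pi.single a 1))) (ρ g y))) := by
      ext g
      have h1 : sρ F p n g v = ∑ a, (∑ b, ent F a b g * v b) • (Pi.single a 1 : Fin n → F) := by
        ext c
        rw [std_apply]
        simp [Finset.sum_apply, Pi.single_apply]
      change l (ρ g y ⊗ₜ (sρ F p n g v)) = _
      rw [h1, TensorProduct.tmul_sum, map_sum, Finset.sum_apply]
      refine Finset.sum_congr rfl fun a _ => ?_
      rw [TensorProduct.tmul_smul, map_smul, Finset.sum_apply, smul_eq_mul, Finset.sum_mul]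
      refine Finset.sum_congr rfl fun b _ => ?_
      simp
      ring
    rw [this]
    refine sum_mem fun a _ => sum_mem fun b _ => Submodule.smul_mem _ _ (ent_mul_mem _ _ _ _ (h _ _))

lemma coef_tensor_left [Fact p.Prime] {A : GRep F (SLP n p)} {j : ℕ} (h : CoefIn A (PolD F p n j)) :
    CoefIn (A.tensor (stdRep p n F)) (PolD F p n (j + 1)) :=
  fun x l => coef_aux A.ρ h x l

lemma coef_aux2 {A : Type*} [AddCommGroup A] [Module F A]
    (ρ : Representation F (SLP n p) A) (a b : Fin n) (x : A) (l : A →ₗ[F] F) (g : SLP n p) :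
    ent F a b g * l (ρ g x) = (TensorProduct.lid F F).toLinearMap.comp
        (TensorProduct.map (LinearMap.proj a : (Fin n → F) →ₗ[F] F) l)
        (((sρ F p n).tprod ρ) g ((Pi.single b 1 : Fin n → F) ⊗ₜ[F] x)) := by
  rw [Representation.tprod_apply]
  simp [std_apply, Pi.single_apply]

lemma coef_path [Fact p.Prime] {W : GRep F (SLP n p)} {k : ℕ}
    (h : Reach (stdRep p n F) (trivialGRep F (SLP n p)) W k) : CoefIn W (PolD F p n k) := by
  obtain ⟨c, h0, hk, hs, hE⟩ := h
  rw [← hk]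
  have : ∀ j ≤ k, CoefIn (c j) (PolD F p n j) := by
    intro j
    induction j with
    | zero =>
      intro _
      rw [h0]
      intro x l
      have : (fun g : SLP n p => l ((trivialGRep F (SLP n p)).ρ g x)) = (l x) • (fun _ => 1) := by
        ext g
        change l x = l x • 1
        simp
      rw [this]
      refine Submodule.smul_mem _ _ (Submodule.subset_span ⟨1, by simp, by simp⟩)
    | succ j ih =>
      intro hj
      exact (coef_tensor_left (ih (by omega))).cf (hE j (by omega))
  exact this k le_rfl

/-- upper -/
lemma exists_NN (e : MonoidAlgebra F (SLP n p)) (z : SLP n p → F)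
    (hz : z ∈ Algebra.adjoin F {f | ∃ a b, f = ent F a b})
    (hne : ∀ m, lam (e ^ m) z ≠ 0) : ∃ k, NN e (T (stdRep p n F) k) := by
  by_contra hcon
  push Not at hcon
  unfold NN at hcon
  push Not at hcon
  have hcoef : ∀ k x (l : (T (stdRep p n F) k).V →ₗ[F] F), ∃ m0, ∀ m ≥ m0,
      lam (e ^ m) (fun g => l ((T (stdRep p n F) k).ρ g x)) = 0 := by
    intro k x l
    obtain ⟨m0, h0⟩ := hcon k
    refine ⟨m0, fun m hm => ?_⟩
    rw [← lam_act, ← Nat.sub_add_cancel hm, pow_add, act_mul, h0]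
    simp
  have hmon : ∀ f ∈ Submonoid.closure {f : SLP n p → F | ∃ a b, f = ent F a b},
      ∃ k x, ∃ l : (T (stdRep p n F) k).V →ₗ[F] F, f = fun g => l ((T (stdRep p n F) k).ρ g x) := by
    intro f hf
    induction hf using Submonoid.closure_induction_left with
    | one => exact ⟨0, (1 : F), (LinearMap.id : F →ₗ[F] F), rfl⟩
    | mul_left f hf y _ hy =>
      obtain ⟨a, b, rfl⟩ := hf
      obtain ⟨k, x, l, rfl⟩ := hy
      refine ⟨k + 1, (Pi.single b 1 : Fin n → F) ⊗ₜ[F] x, (TensorProduct.lid F F).toLinearMap.comp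
        (TensorProduct.map (LinearMap.proj a : (Fin n → F) →ₗ[F] F) l), ?_⟩
      ext g
      exact coef_aux2 (T (stdRep p n F) k).ρ a b x l g
  have hall : ∃ m0, ∀ m ≥ m0, lam (e ^ m) z = 0 := by
    clear hne
    rw [← Subalgebra.mem_toSubmodule, Algebra.adjoin_eq_span] at hz
    induction hz using Submodule.span_induction with
    | mem f hf =>
      obtain ⟨k, x, l, rfl⟩ := hmon f hf
      exact hcoef k x l
    | zero => exact ⟨0, by simp⟩
    | add x y _ _ hx hy =>
      obtain ⟨a, ha⟩ := hx
      obtain ⟨b, hb⟩ := hy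
      refine ⟨max a b, fun m hm => ?_⟩
      rw [map_add, ha m (le_trans (le_max_left _ _) hm), hb m (le_trans (le_max_right _ _) hm),
        add_zero]
    | smul r x _ hx =>
      obtain ⟨a, ha⟩ := hx
      exact ⟨a, fun m hm => by rw [map_smul, ha m hm, smul_zero]⟩
  obtain ⟨m0, h0⟩ := hall
  exact hne m0 (h0 m0 le_rfl)

end MK
namespace MK

section mat
variable {A : Type*} [CommRing A] {n : ℕ}

def Ym (i j : Fin n) (t : A) : Matrix (Fin n) (Fin n) A :=
  Matrix.transvection i j (t - 1) * Matrix.transvection j i 1 * Matrix.transvection i j (-1)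

lemma mul_Ym_i {m : Type*} {i j : Fin n} (hij : i ≠ j) (t : A) (X : Matrix m (Fin n) A) (a : m) :
    (X * Ym i j t) a i = t * X a i + X a j := by
  unfold Ym
  rw [← Matrix.mul_assoc, ← Matrix.mul_assoc, Matrix.mul_transvection_apply_of_ne _ _ _ _ hij,
    Matrix.mul_transvection_apply_same, Matrix.mul_transvection_apply_same,
    Matrix.mul_transvection_apply_of_ne _ _ _ _ hij]
  ring

lemma mul_Ym_j {m : Type*} {i j : Fin n} (hij : i ≠ j) (t : A) (X : Matrix m (Fin n) A) (a : m) :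
    (X * Ym i j t) a j = - X a i := by
  unfold Ym
  rw [← Matrix.mul_assoc, ← Matrix.mul_assoc, Matrix.mul_transvection_apply_same,
    Matrix.mul_transvection_apply_of_ne _ _ _ _ hij.symm,
    Matrix.mul_transvection_apply_same, Matrix.mul_transvection_apply_same,
    Matrix.mul_transvection_apply_of_ne _ _ _ _ hij, Matrix.mul_transvection_apply_same]
  ring

lemma mul_Ym_ne {m : Type*} {i j : Fin n} (t : A) (X : Matrix m (Fin n) A) (a : m)
    (b : Fin n) (hi : b ≠ i) (hj : b ≠ j) :
    (X * Ym i j t) a b = X a b := by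
  unfold Ym
  rw [← Matrix.mul_assoc, ← Matrix.mul_assoc, Matrix.mul_transvection_apply_of_ne _ _ _ _ hj,
    Matrix.mul_transvection_apply_of_ne _ _ _ _ hi, Matrix.mul_transvection_apply_of_ne _ _ _ _ hj]

lemma det_Ym {i j : Fin n} (hij : i ≠ j) (t : A) : (Ym i j t).det = 1 := by
  simp [Ym, Matrix.det_transvection_of_ne _ _ hij, Matrix.det_transvection_of_ne _ _ hij.symm]

def Y (n : ℕ) (a : ℕ) (t : A) : Matrix (Fin n) (Fin n) A :=
  if h : a + 1 < n then Ym ⟨a, by omega⟩ ⟨a + 1, h⟩ t else 1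

lemma ne_aux {a : ℕ} (h : a + 1 < n) : (⟨a, by omega⟩ : Fin n) ≠ ⟨a + 1, h⟩ := by
  simp [Fin.ext_iff]

lemma mul_Y {m : Type*} {a : ℕ} (h : a + 1 < n) (t : A) (X : Matrix m (Fin n) A) (r : m) (b : Fin n) :
    (X * Y n a t) r b = if b.1 = a then t * X r ⟨a, by omega⟩ + X r ⟨a + 1, h⟩ else
      if b.1 = a + 1 then - X r ⟨a, by omega⟩ else X r b := by
  rw [Y, dif_pos h]
  split_ifs with h1 h2
  · have : b = ⟨a, by omega⟩ := Fin.ext h1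
    rw [this, mul_Ym_i (ne_aux h)]
  · have : b = ⟨a + 1, h⟩ := Fin.ext h2
    rw [this, mul_Ym_j (ne_aux h)]
  · rw [mul_Ym_ne]
    · simpa [Fin.ext_iff] using h1
    · simpa [Fin.ext_iff] using h2

lemma det_Y (n a : ℕ) (t : A) : (Y n a t).det = 1 := by
  unfold Y
  split_ifs with h
  · exact det_Ym (ne_aux h) t
  · simp

def YS (n a : ℕ) (t : A) : Matrix.SpecialLinearGroup (Fin n) A := ⟨Y n a t, det_Y n a t⟩

lemma Y_map {B : Type*} [CommRing B] (f : A →+* B) (n a : ℕ) (t : A) :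
    f.mapMatrix (Y n a t) = Y n a (f t) := by
  have key : ∀ (i j : Fin n) (c : A), f.mapMatrix (Matrix.transvection i j c) =
      Matrix.transvection i j (f c) := by
    intro i j c
    ext a b
    simp [Matrix.transvection, Matrix.one_apply, Matrix.single_apply, apply_ite f]
  unfold Y
  split_ifs with h
  · simp only [Ym, map_mul, key, map_sub, map_one, map_neg]
  · simp

def Dk (X : Matrix (Fin n) (Fin n) A) (k : Fin n) : A :=
  (X.submatrix (Fin.castLE k.2.le) (Fin.castLE k.2.le)).det

lemma Dk_ne {a : ℕ} (h : a + 1 < n) (t : A) (X : Matrix (Fin n) (Fin n) A) (k : Fin n)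
    (hk : k ≠ ⟨a + 1, h⟩) : Dk (X * Y n a t) k = Dk X k := by
  unfold Dk
  have hk' : k.1 ≠ a + 1 := by simpa [Fin.ext_iff] using hk
  by_cases hlt : k.1 ≤ a
  · congr 1
    ext r b
    have := b.2
    simp only [Matrix.submatrix_apply]
    rw [mul_Y h, if_neg, if_neg]
    · simp; omega
    · simp; omega
  · have h2 : a + 1 < k.1 := by omega
    have : (X * Y n a t).submatrix (Fin.castLE k.2.le) (Fin.castLE k.2.le) =
        X.submatrix (Fin.castLE k.2.le) (Fin.castLE k.2.le) * Y k.1 a t := by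
      ext r b
      rw [mul_Y h2]
      simp only [Matrix.submatrix_apply]
      rw [mul_Y h]
      rfl
    rw [this, Matrix.det_mul, det_Y, mul_one]

lemma Dk_eq {a : ℕ} (h : a + 1 < n) (X : Matrix (Fin n) (Fin n) A) :
    ∃ β, ∀ t, Dk (X * Y n a t) ⟨a + 1, h⟩ = t * Dk X ⟨a + 1, h⟩ + β := by
  let Z := X.submatrix (Fin.castLE (Nat.le_of_lt h)) (Fin.castLE (Nat.le_of_lt h))
  refine ⟨(Z.updateCol (Fin.last a) (fun r => X (Fin.castLE h.le r) ⟨a + 1, h⟩)).det, fun t => ?_⟩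
  have : (X * Y n a t).submatrix (Fin.castLE h.le) (Fin.castLE h.le) =
      Z.updateCol (Fin.last a) (t • (fun r => Z r (Fin.last a)) +
        (fun r => X (Fin.castLE h.le r) ⟨a + 1, h⟩)) := by
    ext r b
    simp only [Matrix.submatrix_apply]
    rw [mul_Y h, Matrix.updateCol_apply]
    by_cases hb : b = Fin.last a
    · subst hb
      simp [Z]
      rfl
    · have h1 : b.1 ≠ a := by simpa [Fin.ext_iff] using hb
      have := b.2
      rw [if_neg (by simpa using h1), if_neg (by simp; omega), if_neg hb]
      rfl
  unfold Dk
  change ((X * Y n a t).submatrix (Fin.castLE h.le) (Fin.castLE h.le)).det = _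
  rw [this, Matrix.det_updateCol_add, Matrix.det_updateCol_smul]
  congr 2
  change (Z.updateCol (Fin.last a) (Z.col (Fin.last a))).det = Z.det
  congr 1
  ext r b
  rw [Matrix.updateCol_apply]
  split_ifs with hb
  · rw [hb]; rfl
  · rfl

end mat

section fin
variable {p : ℕ} [Fact p.Prime] {n : ℕ}

lemma sum_lin (α β : ZMod p) : ∑ t : ZMod p, (t * α + β) ^ (p - 1) = - α ^ (p - 1) := by
  have hp := (Fact.out : p.Prime).two_le
  by_cases h : α = 0
  · subst h
    simp [zero_pow (show p - 1 ≠ 0 by omega)]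
  · have h1 : ∑ t : ZMod p, (t * α + β) ^ (p - 1) = ∑ s : ZMod p, s ^ (p - 1) := by
      apply Fintype.sum_bijective (fun t => t * α + β)
      · exact ((Equiv.mulRight₀ α h).trans (Equiv.addRight β)).bijective
      · intro; rfl
    have := FiniteField.sum_pow_units (ZMod p) (p - 1)
    rw [h1, ZMod.pow_card_sub_one_eq_one h]
    have h2 : ∀ s : ZMod p, s ^ (p - 1) = 1 - if s = 0 then 1 else 0 := by
      intro s
      rw [ZMod.pow_card_sub_one]
      by_cases hs : s = 0 <;> simp [hs]
    simp [h2]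

def z0 (X : Matrix (Fin n) (Fin n) (ZMod p)) : ZMod p := ∏ k, Dk X k ^ (p - 1)

lemma sum_z0 {a : ℕ} (h : a + 1 < n) (X : Matrix (Fin n) (Fin n) (ZMod p)) :
    ∑ t, z0 (X * Y n a t) = - z0 X := by
  obtain ⟨β, hβ⟩ := Dk_eq h X
  have h1 : ∀ t, z0 (X * Y n a t) = (t * Dk X ⟨a + 1, h⟩ + β) ^ (p - 1) *
      ∏ k ∈ Finset.univ.erase ⟨a + 1, h⟩, Dk X k ^ (p - 1) := by
    intro t
    unfold z0
    rw [← Finset.mul_prod_erase _ _ (Finset.mem_univ (⟨a + 1, h⟩ : Fin n)), hβ]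
    congr 1
    refine Finset.prod_congr rfl fun k hk => ?_
    rw [Dk_ne h _ _ _ (Finset.ne_of_mem_erase hk)]
  simp_rw [h1]
  rw [← Finset.sum_mul, sum_lin, z0,
    ← Finset.mul_prod_erase _ _ (Finset.mem_univ (⟨a + 1, h⟩ : Fin n))]
  ring

variable [CharP F p]

variable (F p n) in
def zf : SLP n p → F := fun g => ZMod.castHom (dvd_refl p) F (z0 g.1)

variable (F p n) in
noncomputable def eL (a : ℕ) : MonoidAlgebra F (SLP n p) :=
  ∑ t : ZMod p, MonoidAlgebra.single (YS n a t) 1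

lemma eL_zf {a : ℕ} (h : a + 1 < n) :
    (R F (SLP n p)).asAlgebraHom (eL F p n a) (zf F p n) = - zf F p n := by
  ext g
  simp only [eL, map_sum, Representation.asAlgebraHom_single, one_smul, LinearMap.sum_apply,
    Finset.sum_apply, R_apply, zf, Pi.neg_apply]
  rw [← map_sum, ← map_neg]
  congr 1
  exact sum_z0 h g.1

lemma eLs_zf (w : List ℕ) (h : ∀ a ∈ w, a + 1 < n) :
    (R F (SLP n p)).asAlgebraHom (w.map (eL F p n)).prod (zf F p n) =
      (-1 : F) ^ w.length • zf F p n := by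
  induction w with
  | nil => simp
  | cons a w ih =>
    have h1 := ih (fun b hb => h b (List.mem_cons_of_mem _ hb))
    rw [List.map_cons, List.prod_cons, map_mul, Module.End.mul_apply, h1, map_smul,
      eL_zf (h a List.mem_cons_self), List.length_cons, pow_succ]
    simp

lemma zf_one : zf F p n 1 = 1 := by
  have : ∀ k : Fin n, Dk (1 : Matrix (Fin n) (Fin n) (ZMod p)) k = 1 := by
    intro k
    unfold Dk
    rw [Matrix.submatrix_one _ (Fin.castLE_injective _), Matrix.det_one]
  have h2 : z0 (1 : Matrix (Fin n) (Fin n) (ZMod p)) = 1 := by simp [z0, this]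
  change ZMod.castHom (dvd_refl p) F (z0 (1 : Matrix (Fin n) (Fin n) (ZMod p))) = 1
  rw [h2, map_one]

lemma lam_pow (w : List ℕ) (h : ∀ a ∈ w, a + 1 < n) (m : ℕ) :
    lam ((w.map (eL F p n)).prod ^ m) (zf F p n) ≠ 0 := by
  have key : (R F (SLP n p)).asAlgebraHom ((w.map (eL F p n)).prod ^ m) (zf F p n) =
      ((-1 : F) ^ w.length) ^ m • zf F p n := by
    induction m with
    | zero => simp
    | succ m ih =>
      rw [pow_succ', map_mul, Module.End.mul_apply, ih, map_smul, eLs_zf w h, smul_smul, pow_succ]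
  change (R F (SLP n p)).asAlgebraHom ((w.map (eL F p n)).prod ^ m) (zf F p n) 1 ≠ 0
  rw [key]
  simp [zf_one]

lemma zf_mem : zf F p n ∈ Algebra.adjoin F {f | ∃ a b, f = ent F a b} := by
  have : zf F p n = ∏ k : Fin n, (∑ σ : Equiv.Perm (Fin k.1), ((σ.sign : ℤ) : F) •
      ∏ i : Fin k.1, ent F (Fin.castLE k.2.le (σ i)) (Fin.castLE k.2.le i)) ^ (p - 1) := by
    ext g
    simp only [zf, z0, Dk, Matrix.det_apply', ent, map_prod, map_pow, map_sum, map_mul,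
      map_intCast, Finset.prod_apply, Pi.pow_apply, Finset.sum_apply, Pi.smul_apply, smul_eq_mul,
      Matrix.submatrix_apply]
  rw [this]
  refine Subalgebra.prod_mem _ fun k _ => Subalgebra.pow_mem _ (Subalgebra.sum_mem _ fun σ _ =>
    Subalgebra.smul_mem _ (Subalgebra.prod_mem _ fun i _ =>
      Algebra.subset_adjoin (Set.mem_setOf.2 ⟨_, _, rfl⟩)) _) _

lemma expand (w : List ℕ) : (w.map (eL F p n)).prod = ∑ t : Fin w.length → ZMod p,
    MonoidAlgebra.single (List.ofFn fun s => YS n (w.get s) (t s)).prod (1 : F) := by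
  induction w with
  | nil => simp [MonoidAlgebra.one_def]
  | cons a w ih =>
    rw [List.map_cons, List.prod_cons, ih]
    symm
    refine ((Fin.consEquiv (fun _ : Fin (w.length + 1) => ZMod p)).sum_comp _).symm.trans ?_
    rw [Fintype.sum_prod_type]
    symm
    rw [eL, Finset.sum_mul]
    refine Finset.sum_congr rfl fun t _ => ?_
    rw [Finset.mul_sum]
    refine Finset.sum_congr rfl fun s _ => ?_
    rw [MonoidAlgebra.single_mul_single, one_mul]
    congr 1
    simp [Fin.consEquiv, List.ofFn_succ]

end fin
end MK
namespace MK

def chain (r : ℕ) : ℕ → List ℕ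
  | 0 => []
  | l + 1 => (r + l) :: chain r l

def word (m : ℕ) : ℕ → List ℕ
  | 0 => []
  | k + 1 => chain (m - (k + 1)) (k + 1) ++ word m k

lemma chain_lt (r l : ℕ) : ∀ a ∈ chain r l, a < r + l := by
  induction l with
  | zero => simp [chain]
  | succ l ih =>
    intro a ha
    rcases List.mem_cons.1 ha with h | h
    · omega
    · have := ih a h; omega

lemma word_lt (m k : ℕ) (hk : k ≤ m) : ∀ a ∈ word m k, a < m := by
  induction k with
  | zero => simp [word]
  | succ k ih =>
    intro a ha
    rcases List.mem_append.1 ha with h | h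
    · have := chain_lt _ _ a h; omega
    · exact ih (by omega) a h

lemma chain_length (r l : ℕ) : (chain r l).length = l := by
  induction l with
  | zero => simp [chain]
  | succ l ih => simp [chain, ih]

lemma word_length (m k : ℕ) : 2 * (word m k).length = k * (k + 1) := by
  induction k with
  | zero => simp [word]
  | succ k ih =>
    rw [word, List.length_append, chain_length, mul_add, ih]; ring

section deg
open MvPolynomial
variable {σ K : Type*} [Field K] {m : ℕ}

def DInv (A : Matrix (Fin (m + 1)) (Fin (m + 1)) (MvPolynomial σ K)) (r acc : ℕ) : Prop :=
  ∀ a b, (A a b).totalDegree ≤ 1 ∧ (r ≤ b.1 → b.1 ≠ acc → (A a b).totalDegree = 0)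

noncomputable def qp (m : ℕ) (Q : List (σ × ℕ)) :
    Matrix (Fin (m + 1)) (Fin (m + 1)) (MvPolynomial σ K) :=
  (Q.map (fun q => Y (m + 1) q.2 (X q.1 : MvPolynomial σ K))).prod

lemma DInv_step (A : Matrix (Fin (m + 1)) (Fin (m + 1)) (MvPolynomial σ K)) (r a : ℕ) (s : σ)
    (ha : a < m) (hr : r ≤ a) (h : DInv A r (a + 1)) :
    DInv (A * Y (m + 1) a (X s)) r a := by
  have h' : a + 1 < m + 1 := by omega
  intro i b
  rw [mul_Y h']
  have h0 := (h i ⟨a, by omega⟩).2 hr (by simp)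
  have h1 := (h i ⟨a + 1, h'⟩).1
  split_ifs with hb hb2
  · refine ⟨(totalDegree_add _ _).trans (max_le ((totalDegree_mul _ _).trans ?_) h1),
      fun _ hne => absurd hb hne⟩
    rw [h0, totalDegree_X]
  · rw [totalDegree_neg, h0]; simp
  · exact ⟨(h i b).1, fun hrb _ => (h i b).2 hrb hb2⟩

lemma DInv_chain (Q : List (σ × ℕ)) (r l : ℕ) (hl : r + l ≤ m) (hQ : Q.map Prod.snd = chain r l)
    (A : Matrix (Fin (m + 1)) (Fin (m + 1)) (MvPolynomial σ K)) (h : DInv A r (r + l)) :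
    DInv (A * qp m Q) r r := by
  induction l generalizing A Q with
  | zero =>
    have : Q = [] := by simpa [chain] using hQ
    subst this
    simpa [qp] using h
  | succ l ih =>
    cases Q with
    | nil => simp [chain] at hQ
    | cons q Q =>
      simp only [chain, List.map_cons, List.cons.injEq] at hQ
      have : A * qp m (q :: Q) = (A * Y (m + 1) q.2 (X q.1)) * qp m Q := by
        simp [qp, mul_assoc]
      rw [this]
      refine ih Q (by omega) hQ.2 _ ?_
      rw [hQ.1]
      exact DInv_step A r (r + l) q.1 (by omega) (by omega) h

lemma DInv_word (Q : List (σ × ℕ)) (k : ℕ) (hk : k ≤ m) (hQ : Q.map Prod.snd = word m k)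
    (A : Matrix (Fin (m + 1)) (Fin (m + 1)) (MvPolynomial σ K)) (h : DInv A (m - k) m) :
    ∀ a b, ((A * qp m Q : Matrix (Fin (m + 1)) (Fin (m + 1)) (MvPolynomial σ K)) a b).totalDegree
      ≤ 1 := by
  induction k generalizing A Q with
  | zero =>
    have : Q = [] := by simpa [word] using hQ
    subst this
    intro a b
    simpa [qp] using (h a b).1
  | succ k ih =>
    obtain ⟨Q1, Q2, rfl, h1, h2⟩ := List.map_eq_append_iff.1 hQ
    have : A * qp m (Q1 ++ Q2) = (A * qp m Q1) * qp m Q2 := by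
      simp [qp, mul_assoc]
    rw [this]
    refine ih Q2 (by omega) h2 _ ?_
    have h3 := DInv_chain Q1 (m - (k + 1)) (k + 1) (by omega) h1 A
      (by rwa [show m - (k + 1) + (k + 1) = m by omega])
    intro a b
    refine ⟨(h3 a b).1, fun hr _ => (h3 a b).2 (by omega) (by omega)⟩

lemma qp_deg (Q : List (σ × ℕ)) (hQ : Q.map Prod.snd = word m m) (a b : Fin (m + 1)) :
    (qp (K := K) m Q a b).totalDegree ≤ 1 := by
  have := DInv_word (K := K) Q m le_rfl hQ 1 (by
    intro a b
    have : ((1 : Matrix (Fin (m + 1)) (Fin (m + 1)) (MvPolynomial σ K)) a b).totalDegree = 0 := by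
      rw [Matrix.one_apply]; split_ifs <;> simp
    simp [this]) a b
  rwa [one_mul] at this

lemma subst_deg {τ : Type*} (P : MvPolynomial τ K) (g : τ → MvPolynomial σ K)
    (hg : ∀ i, (g i).totalDegree ≤ 1) : (aeval g P).totalDegree ≤ P.totalDegree := by
  rw [aeval_def, eval₂_eq]
  refine totalDegree_finsetSum_le fun d hd => ?_
  refine (totalDegree_mul _ _).trans ?_
  rw [algebraMap_eq, totalDegree_C, zero_add]
  refine (totalDegree_finsetProd _ _).trans ?_
  refine le_trans ?_ (le_totalDegree hd)
  refine Finset.sum_le_sum fun i _ => (totalDegree_pow _ _).trans ?_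
  have := Nat.mul_le_mul_left (d i) (hg i)
  rwa [mul_one] at this

end deg

variable {p : ℕ} [Fact p.Prime] [CharP F p] {m : ℕ}

lemma val_prod {n : ℕ} (l : List (SLP n p)) : l.prod.1 = (l.map (fun g => g.1)).prod := by
  induction l with
  | nil => rfl
  | cons g l ih =>
    rw [List.prod_cons, List.map_cons, List.prod_cons, ← ih]
    rfl

lemma lam_zero (j : ℕ) (hj : j < (p - 1) * (word m m).length) (f : SLP (m + 1) p → F)
    (hf : f ∈ PolD F p (m + 1) j) : lam ((word m m).map (eL F p (m + 1))).prod f = 0 := by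
  induction hf using Submodule.span_induction with
  | zero => simp
  | add x y _ _ hx hy => rw [map_add, hx, hy, add_zero]
  | smul r x _ hx => rw [map_smul, hx, smul_zero]
  | mem f hf =>
    obtain ⟨P, hP, rfl⟩ := hf
    set w := word m m with hw
    let Q : List (Fin w.length × ℕ) := List.ofFn fun s => (s, w.get s)
    have hQ : Q.map Prod.snd = w := by
      simp only [Q, List.map_ofFn]
      exact List.ofFn_get w
    let M := qp (K := ZMod p) m Q
    let P' := MvPolynomial.aeval (fun ab : Fin (m + 1) × Fin (m + 1) => M ab.1 ab.2) P
    have hM : ∀ t : Fin w.length → ZMod p, (MvPolynomial.eval t).mapMatrix M =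
        ((List.ofFn fun s => YS (m + 1) (w.get s) (t s)).prod : SLP (m + 1) p).1 := by
      intro t
      have h1 : ((List.ofFn fun s => YS (m + 1) (w.get s) (t s)).prod : SLP (m + 1) p).1 =
          (List.ofFn fun s => Y (m + 1) (w.get s) (t s)).prod := by
        rw [val_prod, List.map_ofFn]
        rfl
      rw [h1]
      simp only [M, qp, Q, map_list_prod, List.map_ofFn]
      congr 2
      ext1 s
      simp only [Function.comp, Y_map, MvPolynomial.eval_X]
    have hE : ∀ t, MvPolynomial.eval t P' = MvPolynomial.eval (fun ab =>
        ((List.ofFn fun s => YS (m + 1) (w.get s) (t s)).prod : SLP (m + 1) p).1 ab.1 ab.2) P := by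
      intro t
      simp only [← hM, P']
      rw [MvPolynomial.aeval_def, MvPolynomial.eval₂_eq, map_sum, MvPolynomial.eval_eq]
      refine Finset.sum_congr rfl fun d _ => ?_
      simp
    have hsum := MvPolynomial.sum_eval_eq_zero P' (by
      rw [ZMod.card, Fintype.card_fin]
      exact (subst_deg P _ (fun ab => qp_deg Q hQ _ _)).trans_lt (hP.trans_lt hj))
    rw [expand]
    simp only [map_sum, lam, Representation.asAlgebraHom_single, one_smul, LinearMap.sum_apply,
      LinearMap.comp_apply, LinearMap.proj_apply, Finset.sum_apply, R_apply, one_mul]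
    rw [← map_sum]
    simp_rw [← hE]
    rw [hsum, map_zero]

end MK
/-- For `G = SL_n(𝔽_p)` and `F` algebraically closed of characteristic `p`, there is a
simple `FG`-module `W` such that the shortest directed path in the McKay graph
`Γ = M_F(G, V_n)` from the class of the trivial module `F` to the class of `W` has
length exactly `(1/2)(p-1)(n²-n)`. -/
theorem mckay_graph_distance_from_trivial (p n : ℕ) (hp : p.Prime) (hn : 2 ≤ n)
    (F : Type u) [Field F] [IsAlgClosed F] [CharP F p] :
    ∃ W : GRep F (SLP n p), W.IsSimple ∧
      (∃ c : ℕ → GRep F (SLP n p),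
        McKayPath (stdRep p n F) (trivialGRep F (SLP n p)) W ((p - 1) * (n ^ 2 - n) / 2) c) ∧
      (∀ (k : ℕ) (c : ℕ → GRep F (SLP n p)),
        McKayPath (stdRep p n F) (trivialGRep F (SLP n p)) W k c →
          (p - 1) * (n ^ 2 - n) / 2 ≤ k) := by
  haveI : Fact p.Prime := ⟨hp⟩
  obtain ⟨m, rfl⟩ : ∃ m, n = m + 1 := ⟨n - 1, by omega⟩
  have hlen : (p - 1) * ((m + 1) ^ 2 - (m + 1)) / 2 = (p - 1) * (MK.word m m).length := by
    have h1 := MK.word_length m m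
    have h2 : (m + 1) ^ 2 - (m + 1) = 2 * (MK.word m m).length := by
      rw [h1]
      have : (m + 1) ^ 2 = m * (m + 1) + (m + 1) := by ring
      omega
    rw [h2, show (p - 1) * (2 * (MK.word m m).length) = 2 * ((p - 1) * (MK.word m m).length) by ring]
    omega
  have hlt : ∀ a ∈ MK.word m m, a + 1 < m + 1 := fun a ha => by
    have := MK.word_lt m m le_rfl a ha
    omega
  obtain ⟨k, hk⟩ := MK.exists_NN ((MK.word m m).map (MK.eL F p (m + 1))).prod (MK.zf F p (m + 1))
    MK.zf_mem (MK.lam_pow _ hlt)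
  haveI : FiniteDimensional F (stdRep p (m + 1) F).V :=
    inferInstanceAs (FiniteDimensional F (Fin (m + 1) → F))
  obtain ⟨W, l, hW, hne⟩ := MK.exists_reach (stdRep p (m + 1) F) _ k hk
  obtain ⟨W', hs, hr, hmin⟩ := MK.interp (stdRep p (m + 1) F) _ W l
    ((p - 1) * ((m + 1) ^ 2 - (m + 1)) / 2) hW (by
      intro j hj
      by_contra hlt'
      rw [hlen, not_le] at hlt'
      exact hne (MK.act_eq_zero (MK.coef_path hj) _ (fun f hf => MK.lam_zero j hlt' f hf)))
  exact ⟨W', hs, hr, fun k c hc => hmin k ⟨c, hc⟩⟩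
end

section
/- Let p be a prime and n ≥ 2, and set L := (1/2)(p−1)(n²−n). There exists a sequence of weights 0̲ = x_0, x_1, …, x_L = St_p such that for each j, x_{j+1} is obtained from x_j by move (a) or by move (b) at some position, and moreover every x_j is p-restricted (all entries lie in {0, 1, …, p−1}). -/
/-- Move (a): `μ = λ + e_1` (`0`-based: `e_1` is `Pi.single 0 1`). -/
def MoveA (n : ℕ) (hn : 2 ≤ n) (lam mu : Fin (n - 1) → ℤ) : Prop :=
  mu = lam + Pi.single (⟨0, by omega⟩ : Fin (n - 1)) 1

/-- Move (b) at position `i`: `μ = λ - e_i + e_{i+1}` where `j` is the successor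
position of `i` (so `1 ≤ i ≤ n-2` in the `1`-based indexing of the paper). -/
def MoveB (n : ℕ) (lam mu : Fin (n - 1) → ℤ) (i j : Fin (n - 1)) : Prop :=
  (j : ℕ) = (i : ℕ) + 1 ∧ mu = lam - Pi.single i 1 + Pi.single j 1

/-- Move (c): `μ = λ - e_{n-1}` (`0`-based: the last coordinate). -/
def MoveC (n : ℕ) (hn : 2 ≤ n) (lam mu : Fin (n - 1) → ℤ) : Prop :=
  mu = lam - Pi.single (⟨n - 2, by omega⟩ : Fin (n - 1)) 1

/-- Potential increased by one by each move. -/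
def wtPot {N : ℕ} (x : Fin N → ℤ) : ℤ := ∑ i : Fin N, ((i : ℕ) + 1 : ℤ) * x i

lemma wtPot_add {N : ℕ} (x y : Fin N → ℤ) : wtPot (x + y) = wtPot x + wtPot y := by
  simp [wtPot, mul_add, Finset.sum_add_distrib]

lemma wtPot_sub {N : ℕ} (x y : Fin N → ℤ) : wtPot (x - y) = wtPot x - wtPot y := by
  simp [wtPot, mul_sub, Finset.sum_sub_distrib]

lemma wtPot_single {N : ℕ} (i : Fin N) : wtPot (Pi.single i (1 : ℤ)) = (i : ℕ) + 1 := by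
  simp [wtPot, Pi.single_apply]

lemma wtPot_const (N : ℕ) (c : ℤ) : wtPot (fun _ : Fin N => c) * 2 = c * (N * (N + 1)) := by
  unfold wtPot
  induction N with
  | zero => simp
  | succ k ih =>
    rw [Fin.sum_univ_castSucc, add_mul]
    simp only [Fin.val_castSucc, Fin.val_last]
    rw [ih]
    push_cast
    ring

lemma wt_step (p n : ℕ) (hp : p.Prime) (hn : 2 ≤ n) (x : Fin (n - 1) → ℤ)
    (hx : ∀ i, 0 ≤ x i ∧ x i ≤ (p : ℤ) - 1) (hne : x ≠ fun _ => (p : ℤ) - 1) :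
    ∃ y : Fin (n - 1) → ℤ, (MoveA n hn x y ∨ ∃ i k : Fin (n - 1), MoveB n x y i k) ∧
      (∀ i, 0 ≤ y i ∧ y i ≤ (p : ℤ) - 1) ∧ wtPot y = wtPot x + 1 := by
  have hp2 : (2 : ℤ) ≤ p := by exact_mod_cast hp.two_le
  have hex : ∃ k : ℕ, ∃ h : k < n - 1, x ⟨k, h⟩ ≠ (p : ℤ) - 1 := by
    by_contra! hcon
    exact hne (funext fun i => hcon i.1 i.2)
  classical
  obtain ⟨hk, hkx⟩ := Nat.find_spec hex
  have hmin := fun m (hm : m < Nat.find hex) => Nat.find_min hex hm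
  generalize Nat.find hex = k at hk hkx hmin
  have hlt : x ⟨k, hk⟩ < (p : ℤ) - 1 := lt_of_le_of_ne (hx _).2 hkx
  rcases k with _ | k
  · refine ⟨x + Pi.single (⟨0, by omega⟩ : Fin (n - 1)) 1, Or.inl rfl, ?_, ?_⟩
    · intro i
      have := hx i
      by_cases hi : i = ⟨0, hk⟩
      · subst hi
        simp only [Pi.add_apply, Pi.single_eq_same]
        omega
      · simpa [Pi.single_eq_of_ne hi] using this
    · rw [wtPot_add, wtPot_single]; simp
  · have hk' : k < n - 1 := by omega
    have hprev : x ⟨k, hk'⟩ = (p : ℤ) - 1 := by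
      by_contra h
      exact hmin k (by omega) ⟨hk', h⟩
    refine ⟨x - Pi.single ⟨k, hk'⟩ 1 + Pi.single ⟨k + 1, hk⟩ 1,
      Or.inr ⟨⟨k, hk'⟩, ⟨k + 1, hk⟩, rfl, rfl⟩, ?_, ?_⟩
    · intro i
      have h1 := hx i
      by_cases hi : i = ⟨k, hk'⟩
      · subst hi
        simp [Pi.single_apply]
        omega
      · by_cases hi' : i = ⟨k + 1, hk⟩
        · subst hi'
          simp [Pi.single_apply]
          omega
        · simpa [Pi.single_eq_of_ne hi, Pi.single_eq_of_ne hi'] using h1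
    · rw [wtPot_add, wtPot_sub, wtPot_single, wtPot_single]; push_cast; ring

/-- For `p` prime and `n ≥ 2`, with `L = (1/2)(p-1)(n²-n)`, there is a sequence of
weights `0̲ = x_0, x_1, …, x_L = St_p = (p-1, …, p-1)` in which each `x_{j+1}` is
obtained from `x_j` by move (a) or by move (b) at some position, and every `x_j` is
`p`-restricted (all entries in `{0, 1, …, p-1}`). -/
theorem exists_move_path_zero_to_steinberg (p n : ℕ) (hp : p.Prime) (hn : 2 ≤ n) :
    ∃ x : ℕ → (Fin (n - 1) → ℤ),
      x 0 = 0 ∧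
      x ((p - 1) * (n ^ 2 - n) / 2) = (fun _ => (p : ℤ) - 1) ∧
      (∀ j < (p - 1) * (n ^ 2 - n) / 2,
        MoveA n hn (x j) (x (j + 1)) ∨
          ∃ i k : Fin (n - 1), MoveB n (x j) (x (j + 1)) i k) ∧
      (∀ j ≤ (p - 1) * (n ^ 2 - n) / 2, ∀ i : Fin (n - 1),
        0 ≤ x j i ∧ x j i ≤ (p : ℤ) - 1) := by
  classical
  set L := (p - 1) * (n ^ 2 - n) / 2 with hL
  have hSt : wtPot (fun _ : Fin (n - 1) => (p : ℤ) - 1) = L := by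
    have h := wtPot_const (n - 1) ((p : ℤ) - 1)
    obtain ⟨m, rfl⟩ : ∃ m, n = m + 1 := ⟨n - 1, by omega⟩
    obtain ⟨q, rfl⟩ : ∃ q, p = q + 1 := ⟨p - 1, by have := hp.two_le; omega⟩
    have e : (m + 1) ^ 2 - (m + 1) = m * (m + 1) := by
      have : (m + 1) ^ 2 = m * (m + 1) + (m + 1) := by ring
      omega
    have hd : 2 ∣ (q + 1 - 1) * (m * (m + 1)) :=
      Dvd.dvd.mul_left (Nat.even_mul_succ_self m).two_dvd _
    have h2 : L * 2 = q * (m * (m + 1)) := by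
      rw [hL, e, Nat.div_mul_cancel hd]; simp
    have h3 : (L : ℤ) * 2 = q * (m * (m + 1)) := by exact_mod_cast h2
    simp only [Nat.add_sub_cancel] at h
    push_cast at h ⊢
    have h4 : ((q : ℤ) + 1 - 1) * (m * (m + 1)) = q * (m * (m + 1)) := by ring
    rw [h4, ← h3] at h
    exact mul_right_cancel₀ two_ne_zero h
  have hp2 : (2 : ℤ) ≤ p := by exact_mod_cast hp.two_le
  choose! f hf1 hf2 hf3 using wt_step p n hp hn
  have key : ∀ j ≤ L, (∀ i, 0 ≤ (f^[j] 0) i ∧ (f^[j] 0) i ≤ (p : ℤ) - 1) ∧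
      wtPot (f^[j] 0) = j := by
    intro j
    induction j with
    | zero =>
      intro _
      refine ⟨fun i => ?_, ?_⟩
      · simp; omega
      · simp [wtPot]
    | succ j ih =>
      intro hj
      obtain ⟨h1, h2⟩ := ih (by omega)
      have hne : f^[j] 0 ≠ fun _ => (p : ℤ) - 1 := by
        intro h
        rw [h, hSt] at h2
        omega
      rw [Function.iterate_succ_apply']
      refine ⟨hf2 _ h1 hne, ?_⟩
      rw [hf3 _ h1 hne, h2]; push_cast; rfl
  refine ⟨fun j => f^[j] 0, rfl, ?_, ?_, fun j hj => (key j hj).1⟩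
  · obtain ⟨h1, h2⟩ := key L le_rfl
    rw [← hSt] at h2
    unfold wtPot at h2
    rw [Finset.sum_eq_sum_iff_of_le
      (fun i _ => mul_le_mul_of_nonneg_left (h1 i).2 (by positivity))] at h2
    funext i
    exact mul_left_cancel₀ (by positivity) (h2 i (Finset.mem_univ i))
  · intro j hj
    obtain ⟨h1, h2⟩ := key j hj.le
    have hne : f^[j] 0 ≠ fun _ => (p : ℤ) - 1 := by
      intro h
      rw [h, hSt] at h2
      omega
    have := hf1 _ h1 hne
    simpa only [Function.iterate_succ_apply'] using this
end

section
/- Let p be a prime and n ≥ 2. For any two p-restricted weights λ and μ there exists an E-path from λ to μ of length at most (1/2)(p−1)(n²−n), i.e., a sequence λ = x_0 →_E x_1 →_E ⋯ →_E x_k = μ of p-restricted weights with k ≤ (1/2)(p−1)(n²−n). -/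
/-- A weight `m ∈ ℤ^{n-1}` is `p`-restricted if `0 ≤ m_i ≤ p-1` for all `i`. -/
def PRestricted (p : ℕ) {k : ℕ} (m : Fin k → ℤ) : Prop :=
  ∀ i, 0 ≤ m i ∧ m i ≤ (p : ℤ) - 1

/-- Move (1): `μ_1` is the unique element of `{1, …, p-1}` congruent to `λ_1 + 1`
mod `(p-1)`, and `μ_i = λ_i` for `i ≠ 1`. (Indices are `0`-based.) -/
def EMove1 (p n : ℕ) (hn : 2 ≤ n) (lam mu : Fin (n - 1) → ℤ) : Prop :=
  1 ≤ mu ⟨0, by omega⟩ ∧ mu ⟨0, by omega⟩ ≤ (p : ℤ) - 1 ∧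
  mu ⟨0, by omega⟩ ≡ lam ⟨0, by omega⟩ + 1 [ZMOD ((p : ℤ) - 1)] ∧
  ∀ i, i ≠ (⟨0, by omega⟩ : Fin (n - 1)) → mu i = lam i

/-- Move (2): the first nonzero entry of `λ` is `λ_s` with `1 ≤ s < n-1`,
`μ_s = λ_s - 1`, `μ_{s+1}` is the unique element of `{1, …, p-1}` congruent to
`λ_{s+1} + 1` mod `(p-1)`, and `μ_i = λ_i` for `i ≠ s, s+1`. (Here `t` is the
successor position of `s`; its existence forces `s < n-1` in `1`-based indexing.) -/
def EMove2 (p n : ℕ) (lam mu : Fin (n - 1) → ℤ) : Prop :=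
  ∃ s t : Fin (n - 1), (t : ℕ) = (s : ℕ) + 1 ∧
    (∀ i < s, lam i = 0) ∧ lam s ≠ 0 ∧
    mu s = lam s - 1 ∧
    1 ≤ mu t ∧ mu t ≤ (p : ℤ) - 1 ∧ mu t ≡ lam t + 1 [ZMOD ((p : ℤ) - 1)] ∧
    ∀ i, i ≠ s → i ≠ t → mu i = lam i

/-- Move (3): the first nonzero entry of `λ` is `λ_{n-1}` (the last entry),
`μ_{n-1} = λ_{n-1} - 1`, and `μ_i = 0` for `i ≠ n-1`. -/
def EMove3 (n : ℕ) (hn : 2 ≤ n) (lam mu : Fin (n - 1) → ℤ) : Prop :=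
  (∀ i, i ≠ (⟨n - 2, by omega⟩ : Fin (n - 1)) → lam i = 0) ∧
  lam ⟨n - 2, by omega⟩ ≠ 0 ∧
  mu ⟨n - 2, by omega⟩ = lam ⟨n - 2, by omega⟩ - 1 ∧
  ∀ i, i ≠ (⟨n - 2, by omega⟩ : Fin (n - 1)) → mu i = 0

/-- The relation `λ →_E μ` on `p`-restricted weights: one of the moves (1), (2), (3). -/
def ERel (p n : ℕ) (hn : 2 ≤ n) (lam mu : Fin (n - 1) → ℤ) : Prop :=
  EMove1 p n hn lam mu ∨ EMove2 p n lam mu ∨ EMove3 n hn lam mu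

inductive EPth (p n : ℕ) (hn : 2 ≤ n) : ℕ → (Fin (n - 1) → ℤ) → (Fin (n - 1) → ℤ) → Prop
  | refl (a : Fin (n - 1) → ℤ) (ha : PRestricted p a) : EPth p n hn 0 a a
  | head (k : ℕ) (a b c : Fin (n - 1) → ℤ) (ha : PRestricted p a) (h : ERel p n hn a b)
      (hbc : EPth p n hn k b c) : EPth p n hn (k + 1) a c

theorem EPth.left {p n : ℕ} {hn : 2 ≤ n} {k : ℕ} {a b : Fin (n - 1) → ℤ}
    (h : EPth p n hn k a b) : PRestricted p a := by
  cases h <;> assumption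

theorem EPth.right {p n : ℕ} {hn : 2 ≤ n} {k : ℕ} {a b : Fin (n - 1) → ℤ}
    (h : EPth p n hn k a b) : PRestricted p b := by
  induction h <;> assumption

theorem EPth.append {p n : ℕ} {hn : 2 ≤ n} {k l : ℕ} {a b c : Fin (n - 1) → ℤ}
    (h : EPth p n hn k a b) (h' : EPth p n hn l b c) : EPth p n hn (k + l) a c := by
  induction h with
  | refl a ha => simpa using h'
  | head k a b c ha h hbc ih =>
    have := EPth.head _ _ _ _ ha h (ih h')
    rwa [show k + 1 + l = k + l + 1 by omega]

theorem EPth.toSeq {p n : ℕ} {hn : 2 ≤ n} {k : ℕ} {a b : Fin (n - 1) → ℤ}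
    (h : EPth p n hn k a b) : ∃ x : ℕ → (Fin (n - 1) → ℤ),
      x 0 = a ∧ x k = b ∧ (∀ j ≤ k, PRestricted p (x j)) ∧
      ∀ j < k, ERel p n hn (x j) (x (j + 1)) := by
  induction h with
  | refl a ha => exact ⟨fun _ => a, rfl, rfl, fun _ _ => ha, fun j hj => by omega⟩
  | head k a b c ha h hbc ih =>
    obtain ⟨x, h0, hk, hr, he⟩ := ih
    refine ⟨fun j => Nat.casesOn j a x, rfl, hk, ?_, ?_⟩
    · rintro (_ | j) hj
      · exact ha
      · exact hr j (by omega)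
    · rintro (_ | j) hj
      · simpa [h0] using h
      · exact he j (by omega)

theorem E_wrap (q : ℕ) (hq : 1 ≤ q) (x : ℤ) (h0 : 0 ≤ x) (h1 : x ≤ q) :
    ∃ v : ℤ, 1 ≤ v ∧ v ≤ q ∧ v ≡ x + 1 [ZMOD q] := by
  by_cases h : x = q
  · refine ⟨1, le_refl _, by omega, ?_⟩
    subst h
    exact (Int.modEq_iff_dvd.2 ⟨1, by ring⟩)
  · exact ⟨x + 1, by omega, by omega, Int.ModEq.refl _⟩

theorem E_uniq (q : ℕ) (v w : ℤ) (h0 : 1 ≤ v) (h1 : v ≤ q) (h2 : 1 ≤ w) (h3 : w ≤ q)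
    (h : v ≡ w [ZMOD q]) : v = w := by
  obtain ⟨c, hc⟩ := Int.modEq_iff_dvd.1 h
  have : c = 0 := by
    by_contra hne
    rcases lt_or_gt_of_ne hne with h | h <;> nlinarith
  subst this; simp at hc; omega

theorem E_diff (q : ℕ) (hq : 1 ≤ q) (x v : ℤ) :
    ∃ d : ℕ, 1 ≤ d ∧ d ≤ q ∧ v ≡ x + d [ZMOD q] := by
  have hq' : (0 : ℤ) < q := by omega
  have e1 := Int.emod_nonneg (v - x - 1) hq'.ne'
  have e2 := Int.emod_lt_of_pos (v - x - 1) hq'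
  refine ⟨((v - x - 1) % q).toNat + 1, by omega, by omega, ?_⟩
  push_cast
  rw [Int.toNat_of_nonneg e1]
  have := Int.mul_ediv_add_emod (v - x - 1) q
  refine Int.modEq_iff_dvd.2 ⟨- ((v - x - 1) / q), ?_⟩
  linarith

section
variable {p n q : ℕ} {hn : 2 ≤ n}

theorem E_cast (hpq : p = q + 1) : (p : ℤ) - 1 = q := by subst hpq; push_cast; ring

/-- `d` moves of type 1. -/
theorem E_one (hpq : p = q + 1) (hq : 1 ≤ q) (o : Fin (n - 1)) (ho : (o : ℕ) = 0) (d : ℕ) :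
    ∀ a : Fin (n - 1) → ℤ, PRestricted p a → ∃ v : ℤ,
      EPth p n hn d a (Function.update a o v) ∧ (d = 0 → v = a o) ∧
      (0 < d → 1 ≤ v ∧ v ≤ q) ∧ v ≡ a o + d [ZMOD q] := by
  have hc := E_cast hpq
  induction d with
  | zero =>
    intro a ha
    refine ⟨a o, ?_, fun _ => rfl, by simp, by simp⟩
    simpa using EPth.refl a ha
  | succ d ih =>
    intro a ha
    have hao := ha o
    rw [hc] at hao
    obtain ⟨w, w1, w2, w3⟩ := E_wrap q hq (a o) hao.1 hao.2
    have hr : PRestricted p (Function.update a o w) := by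
      intro j
      by_cases hj : j = o
      · subst hj; simp; omega
      · simpa [hj] using ha j
    obtain ⟨v, v1, v2, v3, v4⟩ := ih _ hr
    refine ⟨v, ?_, by simp, ?_, ?_⟩
    · refine EPth.head _ _ _ _ ha ?_ (by simpa using v1)
      left
      have h0 : 0 < n - 1 := by clear * - hn; omega
      have : o = ⟨0, h0⟩ := Fin.ext ho
      subst this
      rw [EMove1, hc]
      simp only [Function.update_self]
      refine ⟨w1, w2, w3, fun i hi => by simp [hi]⟩
    · intro _
      rcases Nat.eq_zero_or_pos d with h | h
      · have := v2 h; simp at this; omega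
      · exact v3 h
    · simp only [Function.update_self] at v4
      refine v4.trans ?_
      have := w3.add_right (d : ℤ)
      push_cast
      rwa [show a o + ((d : ℤ) + 1) = a o + 1 + d by ring]

/-- Emptying position `s` into `t`. -/
theorem E_two (hpq : p = q + 1) (hq : 1 ≤ q) (s t : Fin (n - 1)) (hst : (t : ℕ) = s + 1)
    (d : ℕ) : ∀ a : Fin (n - 1) → ℤ, PRestricted p a → (∀ j < s, a j = 0) → a s = d →
      ∃ v : ℤ, EPth p n hn d a (Function.update (Function.update a s 0) t v) ∧
      (d = 0 → v = a t) ∧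
      (0 < d → 1 ≤ v ∧ v ≤ q) ∧ v ≡ a t + d [ZMOD q] := by
  have hc := E_cast hpq
  have hne : t ≠ s := by intro h; subst h; omega
  induction d with
  | zero =>
    intro a ha hz has
    refine ⟨a t, ?_, fun _ => rfl, by simp, by simp⟩
    have : Function.update (Function.update a s 0) t (a t) = a := by
      funext j
      by_cases h1 : j = t
      · subst h1; simp
      · by_cases h2 : j = s
        · subst h2; simp [h1, has]
        · simp [h1, h2]
    rw [this]
    exact EPth.refl a ha
  | succ d ih =>
    intro a ha hz has
    have hat := ha t
    rw [hc] at hat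
    have has' := ha s
    obtain ⟨w, w1, w2, w3⟩ := E_wrap q hq (a t) hat.1 hat.2
    set b := Function.update (Function.update a s d) t w with hb
    have hbt : b t = w := by simp [hb]
    have hbs : b s = d := by simp [hb, hne.symm]
    have hbo : ∀ j, j ≠ s → j ≠ t → b j = a j := by
      intro j h1 h2; simp [hb, h1, h2]
    have hr : PRestricted p b := by
      intro j
      by_cases hj : j = t
      · subst hj; rw [hbt]; omega
      · by_cases hj' : j = s
        · subst hj'; rw [hbs]; push_cast at has; omega
        · rw [hbo j hj' hj]; exact ha j
    obtain ⟨v, v1, v2, v3, v4⟩ := ih b hr (by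
      intro j hj
      rw [hbo j hj.ne (by intro h; subst h; have := Fin.lt_def.1 hj; omega)]
      exact hz j hj) hbs
    rw [hbt] at v2 v4
    refine ⟨v, ?_, by simp, ?_, ?_⟩
    · refine EPth.head _ _ b _ ha ?_ ?_
      · right; left
        refine ⟨s, t, hst, hz, by rw [has]; positivity, by rw [hbs, has]; push_cast; ring,
          by rw [hbt]; exact w1, by rw [hbt, hc]; exact w2, by rw [hbt, hc]; exact w3, hbo⟩
      · convert v1 using 1
        funext j
        by_cases h1 : j = t
        · subst h1; simp
        · by_cases h2 : j = s
          · subst h2; simp [h1]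
          · simp [h1, h2, hbo]
    · intro _
      rcases Nat.eq_zero_or_pos d with h | h
      · have := v2 h; omega
      · exact v3 h
    · refine v4.trans ?_
      have := w3.add_right (d : ℤ)
      push_cast
      rwa [show a t + ((d : ℤ) + 1) = a t + 1 + d by ring]

/-- Emptying the last position. -/
theorem E_three (s : Fin (n - 1)) (hs : (s : ℕ) = n - 2)
    (d : ℕ) : ∀ a : Fin (n - 1) → ℤ, PRestricted p a → (∀ j, j ≠ s → a j = 0) → a s = d →
      EPth p n hn d a (fun _ => 0) := by
  induction d with
  | zero =>
    intro a ha hz has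
    have : a = fun _ => 0 := by
      funext j
      by_cases h : j = s
      · subst h; simpa using has
      · exact hz j h
    subst this
    exact EPth.refl _ ha
  | succ d ih =>
    intro a ha hz has
    have hb : PRestricted p (Function.update a s d) := by
      intro j
      by_cases hj : j = s
      · subst hj; have := ha j; push_cast at has; simp; omega
      · simpa [hj] using ha j
    refine EPth.head _ _ (Function.update a s d) _ ha ?_ (ih _ hb ?_ (by simp))
    · right; right
      have h0 : n - 2 < n - 1 := by clear * - hn; omega
      have : s = ⟨n - 2, h0⟩ := Fin.ext hs
      subst this
      refine ⟨hz, by rw [has]; positivity, by simp [has], fun i hi => by simp [hi, hz i hi]⟩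
    · intro j hj; simp [hj, hz j hj]

theorem E_set (hpq : p = q + 1) (hq : 1 ≤ q) (i : ℕ) : ∀ (hi : i < n - 1)
    (a : Fin (n - 1) → ℤ), PRestricted p a → ∀ v : ℤ, 1 ≤ v → v ≤ q →
      ∃ k ≤ q * (i + 1), EPth p n hn k a
        (fun j => if (j : ℕ) < i then 0 else if (j : ℕ) = i then v else a j) := by
  induction i with
  | zero =>
    intro hi a ha v h1 h2
    obtain ⟨d, d1, d2, d3⟩ := E_diff q hq (a ⟨0, hi⟩) v
    obtain ⟨w, w1, w2, w3, w4⟩ := E_one (hn := hn) hpq hq ⟨0, hi⟩ rfl d a ha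
    obtain ⟨w5, w6⟩ := w3 d1
    have : w = v := E_uniq q w v w5 w6 h1 h2 (w4.trans d3.symm)
    subst this
    refine ⟨d, by simpa using d2, ?_⟩
    convert w1 using 1
    funext j
    by_cases h : j = ⟨0, hi⟩
    · subst h; simp
    · have : (j : ℕ) ≠ 0 := fun h' => h (Fin.ext h')
      simp [h, this]
  | succ i ih =>
    intro hi a ha v h1 h2
    obtain ⟨d, d1, d2, d3⟩ := E_diff q hq (a ⟨i + 1, hi⟩) v
    obtain ⟨k, hk, hp⟩ := ih (by omega) a ha d (by omega) (by omega)
    obtain ⟨w, w1, w2, w3, w4⟩ := E_two (hn := hn) hpq hq ⟨i, by omega⟩ ⟨i + 1, hi⟩ rfl d _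
      hp.right (by
        intro j hj
        have : (j : ℕ) < i := hj
        simp [this]) (by simp)
    obtain ⟨w5, w6⟩ := w3 d1
    simp at w4
    have : w = v := E_uniq q w v w5 w6 h1 h2 (w4.trans d3.symm)
    subst this
    refine ⟨k + d, by nlinarith, ?_⟩
    have := hp.append w1
    convert this using 1
    funext j
    simp only [Function.update_apply, Fin.ext_iff]
    split_ifs <;> first | rfl | omega

theorem E_clear (hpq : p = q + 1) (hq : 1 ≤ q) (i : ℕ) (hi : i < n - 1)
    (a : Fin (n - 1) → ℤ) (ha : PRestricted p a) :
      ∃ k ≤ q * i, ∃ b, EPth p n hn k a b ∧ ∀ j : Fin (n - 1), (j : ℕ) < i → b j = 0 := by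
  induction i with
  | zero => exact ⟨0, by simp, a, EPth.refl a ha, by simp⟩
  | succ i ih =>
    obtain ⟨k, hk, b, hb, hz⟩ := ih (by omega)
    have hr := hb.right ⟨i, by omega⟩
    rw [E_cast hpq] at hr
    obtain ⟨d, hd⟩ := Int.eq_ofNat_of_zero_le hr.1
    obtain ⟨w, w1, -⟩ := E_two (hn := hn) hpq hq ⟨i, by omega⟩ ⟨i + 1, hi⟩ rfl d b
      hb.right (fun j hj => hz j hj) hd
    refine ⟨k + d, by rw [mul_add]; omega, _, hb.append w1, ?_⟩
    intro j hj
    simp only [Function.update_apply, Fin.ext_iff]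
    split_ifs
    · omega
    · rfl
    · exact hz j (by omega)

theorem E_build (hpq : p = q + 1) (hq : 1 ≤ q) (mu : Fin (n - 1) → ℤ) (hmu : PRestricted p mu)
    (i : ℕ) : i ≤ n - 1 → 
    ∀ a : Fin (n - 1) → ℤ, PRestricted p a → (∀ j : Fin (n - 1), (j : ℕ) < i → a j = 0) →
      ∃ k, 2 * k ≤ q * (i * (i + 1)) ∧ EPth p n hn k a
        (fun j => if (j : ℕ) < i then mu j else a j) := by
  induction i with
  | zero => exact fun _ a ha _ => ⟨0, by simp, by simpa using EPth.refl a ha⟩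
  | succ i ih =>
    intro hi a ha hz
    have hm := hmu ⟨i, by omega⟩
    rw [E_cast hpq] at hm
    have key : ∃ k ≤ q * (i + 1), EPth p n hn k a
        (fun j => if (j : ℕ) < i then 0 else if (j : ℕ) = i then mu j else a j) := by
      by_cases h : mu ⟨i, by omega⟩ = 0
      · refine ⟨0, by simp, ?_⟩
        convert EPth.refl (hn := hn) a ha using 1
        funext j
        split_ifs with h1 h2
        · exact (hz j (by omega)).symm
        · have : j = ⟨i, by omega⟩ := Fin.ext h2
          rw [hz j (by omega), this, h]
        · rfl
      · obtain ⟨k, hk, hp⟩ := E_set (hn := hn) hpq hq i (by omega) a ha (mu ⟨i, by omega⟩)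
          (by omega) hm.2
        refine ⟨k, hk, ?_⟩
        convert hp using 1
        funext j
        split_ifs with h1 h2
        · rfl
        · congr 1; exact Fin.ext h2
        · rfl
    obtain ⟨k, hk, hp⟩ := key
    obtain ⟨l, hl, hp'⟩ := ih (by omega) _ hp.right (by intro j hj; simp [hj])
    refine ⟨k + l, by nlinarith, ?_⟩
    convert hp.append hp' using 1
    funext j
    split_ifs <;> first | rfl | omega

end

theorem exists_ERel_path (p n : ℕ) (hp : p.Prime) (hn : 2 ≤ n)
    (lam mu : Fin (n - 1) → ℤ) (hlam : PRestricted p lam) (hmu : PRestricted p mu) :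
    ∃ k ≤ (p - 1) * (n ^ 2 - n) / 2, ∃ x : ℕ → (Fin (n - 1) → ℤ),
      x 0 = lam ∧ x k = mu ∧ (∀ j ≤ k, PRestricted p (x j)) ∧
      ∀ j < k, ERel p n hn (x j) (x (j + 1)) := by
  obtain ⟨q, hpq⟩ : ∃ q, p = q + 1 := ⟨p - 1, by have := hp.two_le; omega⟩
  have hq : 1 ≤ q := by have := hp.two_le; omega
  have hi : n - 2 < n - 1 := by omega
  have hm := hmu ⟨n - 2, hi⟩
  rw [E_cast hpq] at hm
  have key : ∃ k ≤ q * (n - 1), ∃ b, EPth p n hn k lam b ∧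
      (∀ j : Fin (n - 1), (j : ℕ) < n - 2 → b j = 0) ∧ b ⟨n - 2, hi⟩ = mu ⟨n - 2, hi⟩ := by
    by_cases h : mu ⟨n - 2, hi⟩ = 0
    · obtain ⟨k, hk, b, hb, hz⟩ := E_clear (hn := hn) hpq hq (n - 2) hi lam hlam
      have hr := hb.right ⟨n - 2, hi⟩
      rw [E_cast hpq] at hr
      obtain ⟨d, hd⟩ := Int.eq_ofNat_of_zero_le hr.1
      have h3 := E_three (hn := hn) ⟨n - 2, hi⟩ rfl d b hb.right (fun j hj => hz j (by
        have : (j : ℕ) ≠ n - 2 := fun h' => hj (Fin.ext h')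
        omega)) hd
      refine ⟨k + d, ?_, _, hb.append h3, fun _ _ => rfl, h.symm⟩
      rw [show n - 1 = (n - 2) + 1 by omega, mul_add]; omega
    · obtain ⟨k, hk, hp⟩ := E_set (hn := hn) hpq hq (n - 2) hi lam hlam (mu ⟨n - 2, hi⟩)
          (by omega) hm.2
      refine ⟨k, ?_, _, hp, fun j hj => by simp [hj], by simp⟩
      rwa [show n - 1 = (n - 2) + 1 by omega]
  obtain ⟨k, hk, b, hb, hz, hl⟩ := key
  obtain ⟨l, hl', hb'⟩ := E_build (hn := hn) hpq hq mu hmu (n - 2) (by omega) b hb.right hz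
  have hfin : (fun j : Fin (n - 1) => if (j : ℕ) < n - 2 then mu j else b j) = mu := by
    funext j
    split_ifs with h
    · rfl
    · have : j = ⟨n - 2, hi⟩ := Fin.ext (by have := j.2; simp; omega)
      rw [this, hl]
  rw [hfin] at hb'
  refine ⟨k + l, ?_, (hb.append hb').toSeq⟩
  rw [Nat.le_div_iff_mul_le (by norm_num)]
  obtain ⟨m, rfl⟩ : ∃ m, n = m + 2 := ⟨n - 2, by omega⟩
  have e1 : p - 1 = q := by omega
  have e2 : (m + 2) ^ 2 - (m + 2) = (m + 1) * (m + 2) := by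
    rw [Nat.sub_eq_iff_eq_add (by nlinarith)]; ring
  rw [e1, e2]
  simp only [Nat.add_sub_cancel, show m + 2 - 1 = m + 1 by omega] at hk hl'
  nlinarith
end

section
/- Let p be a prime and n ≥ 2, and set L := (1/2)(p−1)(n²−n). Then the minimal length of an E-path from the zero weight 0̲ to St_p = (p−1, …, p−1) equals L: there exists an E-path from 0̲ to St_p of length L, and every E-path from 0̲ to St_p has length at least L. -/
def Phi (n : ℕ) (l : Fin (n - 1) → ℤ) : ℤ := ∑ i : Fin (n - 1), (((i : ℕ) : ℤ) + 1) * l i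

lemma Phi_one (n : ℕ) (l m : Fin (n - 1) → ℤ) (s : Fin (n - 1))
    (h : ∀ i, i ≠ s → m i = l i) :
    Phi n m = Phi n l + ((s : ℕ) + 1 : ℤ) * (m s - l s) := by
  have : Phi n m - Phi n l = ((s : ℕ) + 1 : ℤ) * (m s - l s) := by
    unfold Phi
    rw [← Finset.sum_sub_distrib, Finset.sum_eq_single s]
    · ring
    · intro b _ hb
      rw [h b hb]; ring
    · simp
  linarith

lemma Phi_two (n : ℕ) (l m : Fin (n - 1) → ℤ) (s t : Fin (n - 1)) (hst : s ≠ t)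
    (h : ∀ i, i ≠ s → i ≠ t → m i = l i) :
    Phi n m = Phi n l + ((s : ℕ) + 1 : ℤ) * (m s - l s) + ((t : ℕ) + 1 : ℤ) * (m t - l t) := by
  have : Phi n m - Phi n l
      = ((s : ℕ) + 1 : ℤ) * (m s - l s) + ((t : ℕ) + 1 : ℤ) * (m t - l t) := by
    unfold Phi
    rw [← Finset.sum_sub_distrib, Finset.sum_eq_add s t hst]
    · ring
    · intro b _ hb
      rw [h b hb.1 hb.2]; ring
    · simp
    · simp
  linarith

lemma modle (q a b : ℤ) (hb : 0 ≤ b) (ha : a ≤ q) (h : a ≡ b + 1 [ZMOD q]) : a ≤ b + 1 := by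
  by_contra hc
  push Not at hc
  have h2 := Int.le_of_dvd (by linarith) h.symm.dvd
  linarith

lemma Phi_step (p n : ℕ) (hn : 2 ≤ n) (l m : Fin (n - 1) → ℤ) (hl : PRestricted p l)
    (h : ERel p n hn l m) : Phi n m ≤ Phi n l + 1 := by
  rcases h with ⟨h1, h2, h3, h4⟩ | ⟨s, t, hst, _, _, h1, h2, h3, h4, h5⟩ | ⟨h1, h2, h3, h4⟩
  · rw [Phi_one n l m _ h4]
    have := modle _ _ _ (hl _).1 h2 h3
    simp only [Nat.cast_zero]
    linarith
  · have hne : s ≠ t := by rintro rfl; omega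
    rw [Phi_two n l m s t hne h5, h1, hst]
    have := modle _ _ _ (hl _).1 h3 h4
    push_cast
    nlinarith [Int.natCast_nonneg (s : ℕ)]
  · rw [Phi_one n l m ⟨n - 2, by omega⟩ (fun i hi => by rw [h1 i hi, h4 i hi]), h3]
    have := Int.natCast_nonneg (n - 2)
    simp only
    linarith

lemma Phi_St (p n : ℕ) (hp : 1 ≤ p) (hn : 2 ≤ n) :
    Phi n (fun _ => (p : ℤ) - 1) = (((p - 1) * (n ^ 2 - n) / 2 : ℕ) : ℤ) := by
  obtain ⟨k, rfl⟩ : ∃ k, n = k + 1 := ⟨n - 1, by omega⟩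
  obtain ⟨q, rfl⟩ : ∃ q, p = q + 1 := ⟨p - 1, by omega⟩
  have h1 : ∀ k : ℕ, (∑ i : Fin k, (((i : ℕ) : ℤ) + 1)) * 2 = k * (k + 1) := by
    intro k
    induction k with
    | zero => simp
    | succ k ih =>
      rw [Fin.sum_univ_castSucc, add_mul]
      simp only [Fin.val_castSucc, Fin.val_last]
      rw [ih]; push_cast; ring
  have h2 : (k + 1) ^ 2 - (k + 1) = k * (k + 1) := by
    rw [pow_two, ← Nat.sub_one_mul]; simp
  have h3 : Phi (k + 1) (fun _ => ((q + 1 : ℕ) : ℤ) - 1) * 2 = ((q * (k * (k + 1)) : ℕ) : ℤ) := by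
    unfold Phi
    rw [← Finset.sum_mul]
    have := h1 k
    push_cast
    change (∑ i : Fin k, (((i : ℕ) : ℤ) + 1)) * _ * 2 = _
    linear_combination (q : ℤ) * this
  rw [h2, show q + 1 - 1 = q from rfl]
  push_cast at h3 ⊢
  omega

lemma Phi_eq_St (p n : ℕ) (l : Fin (n - 1) → ℤ) (hl : PRestricted p l)
    (h : Phi n l = Phi n (fun _ => (p : ℤ) - 1)) : l = (fun _ => (p : ℤ) - 1) := by
  unfold Phi at h
  rw [Finset.sum_eq_sum_iff_of_le] at h
  · funext i
    have := h i (Finset.mem_univ _)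
    have h0 := Int.natCast_nonneg (i : ℕ)
    exact mul_left_cancel₀ (by linarith) this
  · intro i _
    have h0 := Int.natCast_nonneg (i : ℕ)
    exact mul_le_mul_of_nonneg_left (hl i).2 (by linarith)

/-- active chip at s, current target m holding c, everything above m full -/
def st (q : ℤ) (k s m : ℕ) (c : ℤ) : Fin k → ℤ := fun i =>
  (if m < (i : ℕ) then q else if (i : ℕ) = m then c else 0) + (if (i : ℕ) = s then 1 else 0)

def Good (p n : ℕ) (l : Fin (n - 1) → ℤ) : Prop :=
  l = 0 ∨ ∃ (s m : ℕ) (c : ℤ), s ≤ m ∧ m < n - 1 ∧ 0 ≤ c ∧ c + 1 ≤ (p : ℤ) - 1 ∧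
    l = st ((p : ℤ) - 1) (n - 1) s m c

lemma Good.restr {p n : ℕ} (hp : 2 ≤ p) {l : Fin (n - 1) → ℤ} (h : Good p n l) :
    PRestricted p l := by
  intro i
  rcases h with rfl | ⟨s, m, c, h1, h2, h3, h4, rfl⟩
  · simp; omega
  · unfold st
    split_ifs <;> omega

lemma mv1 (p n : ℕ) (hn : 2 ≤ n) (l m : Fin (n - 1) → ℤ) 
    (h1 : m ⟨0, by omega⟩ = l ⟨0, by omega⟩ + 1) (h0 : 0 ≤ l ⟨0, by omega⟩)
    (h2 : m ⟨0, by omega⟩ ≤ (p : ℤ) - 1)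
    (h : ∀ i : Fin (n - 1), (i : ℕ) ≠ 0 → m i = l i) : ERel p n hn l m ∧ Phi n m = Phi n l + 1 := by
  have h' : ∀ i, i ≠ (⟨0, by omega⟩ : Fin (n - 1)) → m i = l i := by
    intro i hi
    exact h i (fun hh => hi (Fin.ext hh))
  refine ⟨Or.inl ⟨by omega, h2, by rw [h1], h'⟩, ?_⟩
  rw [Phi_one n l m _ h', h1]
  simp

lemma Good.next {p n : ℕ} (hp : 2 ≤ p) (hn : 2 ≤ n) {l : Fin (n - 1) → ℤ} (h : Good p n l)
    (hne : l ≠ fun _ => (p : ℤ) - 1) :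
    ∃ m, Good p n m ∧ ERel p n hn l m ∧ Phi n m = Phi n l + 1 := by
  rcases h with rfl | ⟨s, m, c, h1, h2, h3, h4, rfl⟩
  · refine ⟨_, Or.inr ⟨0, n - 2, 0, by omega, by omega, le_rfl, by omega, rfl⟩, ?_⟩
    apply mv1
    · simp only [st, Pi.zero_apply]; split_ifs <;> omega
    · simp
    · simp only [st]; split_ifs <;> omega
    · intro i hi
      have := i.2
      simp only [st, Pi.zero_apply]; split_ifs <;> omega
  by_cases hs : s < m
  · refine ⟨_, Or.inr ⟨s + 1, m, c, by omega, by omega, h3, h4, rfl⟩, ?_⟩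
    have e1 : st ((p : ℤ) - 1) (n - 1) (s + 1) m c ⟨s, by omega⟩
        = st ((p : ℤ) - 1) (n - 1) s m c ⟨s, by omega⟩ - 1 := by
      simp only [st]; split_ifs <;> omega
    have e2 : st ((p : ℤ) - 1) (n - 1) (s + 1) m c ⟨s + 1, by omega⟩
        = st ((p : ℤ) - 1) (n - 1) s m c ⟨s + 1, by omega⟩ + 1 := by
      simp only [st]; split_ifs <;> omega
    have e3 : ∀ i : Fin (n - 1), i ≠ ⟨s, by omega⟩ → i ≠ ⟨s + 1, by omega⟩ →
        st ((p : ℤ) - 1) (n - 1) (s + 1) m c i = st ((p : ℤ) - 1) (n - 1) s m c i := by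
      intro i hi hj
      have hi' : (i : ℕ) ≠ s := fun hh => hi (Fin.ext hh)
      have hj' : (i : ℕ) ≠ s + 1 := fun hh => hj (Fin.ext hh)
      simp only [st]; split_ifs <;> omega
    constructor
    · refine Or.inr (Or.inl ⟨⟨s, by omega⟩, ⟨s + 1, by omega⟩, rfl, ?_, ?_, e1, ?_, ?_, ?_, e3⟩)
      · intro i hi
        have : (i : ℕ) < s := hi
        simp only [st]; split_ifs <;> omega
      · simp only [st]; split_ifs <;> omega
      · simp only [st]; split_ifs <;> omega
      · simp only [st]; split_ifs <;> omega
      · rw [e2]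
    · rw [Phi_two n _ _ ⟨s, by omega⟩ ⟨s + 1, by omega⟩ (by simp) e3, e1, e2]
      push_cast
      ring
  obtain rfl : s = m := by omega
  by_cases hc : c + 1 + 1 ≤ (p : ℤ) - 1
  · refine ⟨_, Or.inr ⟨0, s, c + 1, by omega, by omega, by omega, hc, rfl⟩, ?_⟩
    apply mv1
    · simp only [st]; split_ifs <;> omega
    · simp only [st]; split_ifs <;> omega
    · simp only [st]; split_ifs <;> omega
    · intro i hi
      simp only [st]; split_ifs <;> omega
  have hs0 : s ≠ 0 := by
    rintro rfl
    apply hne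
    funext i
    simp only [st]; split_ifs <;> omega
  refine ⟨_, Or.inr ⟨0, s - 1, 0, by omega, by omega, by omega, by omega, rfl⟩, ?_⟩
  apply mv1
  · simp only [st]; split_ifs <;> omega
  · simp only [st]; split_ifs <;> omega
  · simp only [st]; split_ifs <;> omega
  · intro i hi
    simp only [st]; split_ifs <;> omega

/-- The minimal length of an `E`-path from the zero weight `0̲` to
`St_p = (p-1, …, p-1)` is exactly `L = (1/2)(p-1)(n²-n)`: there is such a path of
length `L`, and every such path has length at least `L`. -/
theorem ERel_path_zero_to_steinberg (p n : ℕ) (hp : p.Prime) (hn : 2 ≤ n) :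
    (∃ x : ℕ → (Fin (n - 1) → ℤ),
      x 0 = 0 ∧ x ((p - 1) * (n ^ 2 - n) / 2) = (fun _ => (p : ℤ) - 1) ∧
      (∀ j ≤ (p - 1) * (n ^ 2 - n) / 2, PRestricted p (x j)) ∧
      ∀ j < (p - 1) * (n ^ 2 - n) / 2, ERel p n hn (x j) (x (j + 1))) ∧
    (∀ (k : ℕ) (x : ℕ → (Fin (n - 1) → ℤ)),
      x 0 = 0 → x k = (fun _ => (p : ℤ) - 1) →
      (∀ j ≤ k, PRestricted p (x j)) →
      (∀ j < k, ERel p n hn (x j) (x (j + 1))) →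
      (p - 1) * (n ^ 2 - n) / 2 ≤ k) := by
  have hp2 := hp.two_le
  have hSt := Phi_St p n (by omega) hn
  have hz : Phi n (0 : Fin (n - 1) → ℤ) = 0 := by simp [Phi]
  generalize (p - 1) * (n ^ 2 - n) / 2 = L at *
  constructor
  · have hex : ∀ l : Fin (n - 1) → ℤ, ∃ m, Good p n l → (l ≠ fun _ => (p : ℤ) - 1) →
        Good p n m ∧ ERel p n hn l m ∧ Phi n m = Phi n l + 1 := by
      intro l
      by_cases h : Good p n l ∧ l ≠ fun _ => (p : ℤ) - 1
      · obtain ⟨m, hm⟩ := h.1.next hp2 hn h.2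
        exact ⟨m, fun _ _ => hm⟩
      · exact ⟨l, fun h1 h2 => absurd ⟨h1, h2⟩ h⟩
    choose f hf using hex
    have key : ∀ j : ℕ, j ≤ L → Good p n (f^[j] 0) ∧ Phi n (f^[j] 0) = j := by
      intro j
      induction j with
      | zero => intro _; exact ⟨Or.inl rfl, by simpa using hz⟩
      | succ j ih =>
        intro hj
        obtain ⟨g, hg⟩ := ih (by omega)
        have := hf _ g (by intro hh; rw [hh, hSt] at hg; omega)
        rw [Function.iterate_succ_apply']
        refine ⟨this.1, ?_⟩
        rw [this.2.2, hg]; push_cast; rfl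
    refine ⟨fun j => f^[j] 0, rfl, ?_, fun j hj => (key j hj).1.restr hp2, ?_⟩
    · exact Phi_eq_St p n _ ((key L le_rfl).1.restr hp2) (by rw [(key L le_rfl).2, hSt])
    · intro j hj
      obtain ⟨g, hg⟩ := key j hj.le
      have := hf _ g (by intro hh; rw [hh, hSt] at hg; omega)
      simp only [Function.iterate_succ_apply']
      exact this.2.1
  · intro k x h0 hk hr hE
    have key : ∀ j : ℕ, j ≤ k → Phi n (x j) ≤ j := by
      intro j
      induction j with
      | zero => intro _; rw [h0, hz]; simp
      | succ j ih =>
        intro hj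
        have := Phi_step p n hn _ _ (hr j (by omega)) (hE j (by omega))
        have := ih (by omega)
        push_cast; linarith
    have := key k le_rfl
    rw [hk, hSt] at this
    exact_mod_cast this
end
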